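/- arXiv:1310.4355 — 3 statements merged into one kernel-verified Lean document; each statement's English description precedes it below -/
import Mathlib

section
/- Let L>0. Assume hypothesis (H): for every δ>0 there exist constants C_δ>0 and T_δ>0 such that for every T∈(0,T_δ) and every Dirichlet heat solution φ on [0,∞) (with all integrals below finite): ∫_0^∞∫_0^L e^{-L²/(2t)} φ(t,x)² dx dt ≤ C_δ e^{δ/T} ∫_0^T (∂_xφ(t,0))² dt. Then for every K>L²/4 there exist C(K)>0 and T₀>0 such that for every T∈(0,T₀) and every Dirichlet heat solution φ on [0,∞) (with all integrals finite): ∫_0^L φ(T,x)² dx ≤ C(K)·e^{2K/T}·∫_0^T (∂_xφ(t,0))² dt. -/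
open MeasureTheory

/-- A "Dirichlet heat solution on `[0,∞)`" for the interval `[0,L]`:
`φ : [0,∞) × [0,L] → ℝ` continuous, `C¹` in `t` and `C²` in `x` on `(0,∞) × [0,L]`,
satisfying `∂_t φ = ∂_{xx} φ` for `t > 0`, `x ∈ (0,L)`, with homogeneous Dirichlet
boundary conditions.  The derivatives are given by the data `φt`, `φx`, `φxx`. -/
structure IsDirichletHeatSol (L : ℝ) (φ φt φx φxx : ℝ → ℝ → ℝ) : Prop where
  cont : ContinuousOn (fun p : ℝ × ℝ => φ p.1 p.2) (Set.Ici 0 ×ˢ Set.Icc 0 L)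
  ht : ∀ t > (0 : ℝ), ∀ x ∈ Set.Icc (0 : ℝ) L,
    HasDerivAt (fun τ => φ τ x) (φt t x) t
  htc : ∀ x ∈ Set.Icc (0 : ℝ) L, ContinuousOn (fun t => φt t x) (Set.Ioi 0)
  hx : ∀ t > (0 : ℝ), ∀ x ∈ Set.Icc (0 : ℝ) L,
    HasDerivWithinAt (fun ξ => φ t ξ) (φx t x) (Set.Icc 0 L) x
  hxc : ∀ t > (0 : ℝ), ContinuousOn (fun x => φx t x) (Set.Icc 0 L)
  hxx : ∀ t > (0 : ℝ), ∀ x ∈ Set.Icc (0 : ℝ) L,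
    HasDerivWithinAt (fun ξ => φx t ξ) (φxx t x) (Set.Icc 0 L) x
  hxxc : ∀ t > (0 : ℝ), ContinuousOn (fun x => φxx t x) (Set.Icc 0 L)
  pde : ∀ t > (0 : ℝ), ∀ x ∈ Set.Ioo (0 : ℝ) L, φt t x = φxx t x
  bc0 : ∀ t ≥ (0 : ℝ), φ t 0 = 0
  bcL : ∀ t ≥ (0 : ℝ), φ t L = 0

section HeatSolutions

open Set Filter Topology

/-- A `C²`-type necessary condition: the second derivative is nonpositive at a local maximum. -/
theorem IsLocalMax.second_deriv_nonpos {f f' : ℝ → ℝ} {f'' x₀ : ℝ} (hmax : IsLocalMax f x₀)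
    (hf : ∀ᶠ x in 𝓝 x₀, HasDerivAt f (f' x) x) (hf' : HasDerivAt f' f'' x₀) : f'' ≤ 0 := by
  by_contra! hpos
  have hd : deriv f =ᶠ[𝓝 x₀] f' := hf.mono fun x hx => hx.deriv
  have hdd : deriv (deriv f) x₀ = f'' := by rw [hd.deriv_eq, hf'.deriv]
  have hmin : IsLocalMin f x₀ :=
    isLocalMin_of_deriv_deriv_pos (by rwa [hdd]) hmax.deriv_eq_zero hf.self_of_nhds.continuousAt
  have hconst : f =ᶠ[𝓝 x₀] fun _ => f x₀ := by
    filter_upwards [hmax, hmin] with x h₁ h₂ using le_antisymm h₁ h₂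
  have hzero : deriv f =ᶠ[𝓝 x₀] fun _ => 0 := by
    filter_upwards [hconst.deriv] with x hx
    simp [hx]
  have : deriv (deriv f) x₀ = 0 := by simp [hzero.deriv_eq]
  linarith

/-- The derivative is nonnegative at a point where `f` is maximal among earlier points. -/
theorem HasDerivAt.nonneg_of_forall_le_left {f : ℝ → ℝ} {f' s t : ℝ} (hst : s < t)
    (hf : HasDerivAt f f' t) (hle : ∀ τ ∈ Icc s t, f τ ≤ f t) : 0 ≤ f' := by
  have hlim := hasDerivWithinAt_iff_tendsto_slope.1 (hf.hasDerivWithinAt (s := Iio t))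
  rw [sdiff_singleton_eq_self (by simp)] at hlim
  refine ge_of_tendsto hlim ?_
  filter_upwards [Ico_mem_nhdsLT hst] with τ hτ
  rw [slope_def_field]
  exact div_nonneg_of_nonpos (sub_nonpos.2 (hle τ ⟨hτ.1, hτ.2.le⟩)) (sub_nonpos.2 hτ.2.le)

namespace IsDirichletHeatSol

variable {L : ℝ} {φ φt φx φxx ψ ψt ψx ψxx : ℝ → ℝ → ℝ}

theorem continuousOn_slice (h : IsDirichletHeatSol L φ φt φx φxx) {t : ℝ} (ht : 0 ≤ t) :
    ContinuousOn (φ t) (Icc 0 L) :=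
  h.cont.comp (f := fun x => (t, x)) (by fun_prop) fun _ hx => ⟨ht, hx⟩

theorem zero : IsDirichletHeatSol L (fun _ _ => 0) (fun _ _ => 0) (fun _ _ => 0)
    (fun _ _ => 0) where
  cont := continuousOn_const
  ht _ _ _ _ := hasDerivAt_const _ _
  htc _ _ := continuousOn_const
  hx _ _ _ _ := hasDerivWithinAt_const _ _ _
  hxc _ _ := continuousOn_const
  hxx _ _ _ _ := hasDerivWithinAt_const _ _ _
  hxxc _ _ := continuousOn_const
  pde _ _ _ _ := rfl
  bc0 _ _ := rfl
  bcL _ _ := rfl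

theorem add (h : IsDirichletHeatSol L φ φt φx φxx) (k : IsDirichletHeatSol L ψ ψt ψx ψxx) :
    IsDirichletHeatSol L (fun t x => φ t x + ψ t x) (fun t x => φt t x + ψt t x)
      (fun t x => φx t x + ψx t x) (fun t x => φxx t x + ψxx t x) where
  cont := h.cont.add k.cont
  ht t ht x hx := (h.ht t ht x hx).add (k.ht t ht x hx)
  htc x hx := (h.htc x hx).add (k.htc x hx)
  hx t ht x hx := (h.hx t ht x hx).add (k.hx t ht x hx)
  hxc t ht := (h.hxc t ht).add (k.hxc t ht)
  hxx t ht x hx := (h.hxx t ht x hx).add (k.hxx t ht x hx)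
  hxxc t ht := (h.hxxc t ht).add (k.hxxc t ht)
  pde t ht x hx := by rw [h.pde t ht x hx, k.pde t ht x hx]
  bc0 t ht := by simp [h.bc0 t ht, k.bc0 t ht]
  bcL t ht := by simp [h.bcL t ht, k.bcL t ht]

theorem const_mul (h : IsDirichletHeatSol L φ φt φx φxx) (c : ℝ) :
    IsDirichletHeatSol L (fun t x => c * φ t x) (fun t x => c * φt t x)
      (fun t x => c * φx t x) (fun t x => c * φxx t x) where
  cont := continuousOn_const.mul h.cont
  ht t ht x hx := (h.ht t ht x hx).const_mul c
  htc x hx := continuousOn_const.mul (h.htc x hx)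
  hx t ht x hx := (h.hx t ht x hx).const_mul c
  hxc t ht := continuousOn_const.mul (h.hxc t ht)
  hxx t ht x hx := (h.hxx t ht x hx).const_mul c
  hxxc t ht := continuousOn_const.mul (h.hxxc t ht)
  pde t ht x hx := by rw [h.pde t ht x hx]
  bc0 t ht := by simp [h.bc0 t ht]
  bcL t ht := by simp [h.bcL t ht]

theorem shift (h : IsDirichletHeatSol L φ φt φx φxx) {s : ℝ} (hs : 0 ≤ s) :
    IsDirichletHeatSol L (fun t => φ (t + s)) (fun t => φt (t + s))
      (fun t => φx (t + s)) (fun t => φxx (t + s)) where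
  cont := h.cont.comp (f := fun p : ℝ × ℝ => (p.1 + s, p.2)) (by fun_prop)
    fun p hp => ⟨add_nonneg (mem_Ici.1 hp.1) hs, hp.2⟩
  ht t ht x hx := (h.ht (t + s) (by linarith) x hx).comp_add_const t s
  htc x hx := (h.htc x hx).comp (f := fun t => t + s) (by fun_prop)
    fun t ht => add_pos_of_pos_of_nonneg (mem_Ioi.1 ht) hs
  hx t ht := h.hx (t + s) (by linarith)
  hxc t ht := h.hxc (t + s) (by linarith)
  hxx t ht := h.hxx (t + s) (by linarith)
  hxxc t ht := h.hxxc (t + s) (by linarith)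
  pde t ht := h.pde (t + s) (by linarith)
  bc0 t ht := h.bc0 (t + s) (by linarith)
  bcL t ht := h.bcL (t + s) (by linarith)

theorem sineMode {k : ℝ} (hk : Real.sin (k * L) = 0) :
    IsDirichletHeatSol L (fun t x => Real.exp (-k ^ 2 * t) * Real.sin (k * x))
      (fun t x => Real.exp (-k ^ 2 * t) * -k ^ 2 * Real.sin (k * x))
      (fun t x => Real.exp (-k ^ 2 * t) * (Real.cos (k * x) * k))
      (fun t x => Real.exp (-k ^ 2 * t) * (-Real.sin (k * x) * k * k)) where
  cont := by fun_prop
  ht t _ x _ := by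
    have := ((hasDerivAt_id t).const_mul (-k ^ 2)).exp.mul_const (Real.sin (k * x))
    simpa using this
  htc x _ := by fun_prop
  hx t _ x _ := by
    have := (((hasDerivAt_id x).const_mul k).sin.const_mul (Real.exp (-k ^ 2 * t)))
    simpa using this.hasDerivWithinAt
  hxc t _ := by fun_prop
  hxx t _ x _ := by
    have := ((((hasDerivAt_id x).const_mul k).cos.mul_const k).const_mul (Real.exp (-k ^ 2 * t)))
    simpa using this.hasDerivWithinAt
  hxxc t _ := by fun_prop
  pde t _ x _ := by ring
  bc0 t _ := by simp
  bcL t _ := by simp [hk]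

/-- The weak maximum principle. -/
theorem le_of_initial_le (h : IsDirichletHeatSol L φ φt φx φxx) {M : ℝ} (hM : 0 ≤ M)
    (h0 : ∀ x ∈ Icc 0 L, φ 0 x ≤ M) {T x : ℝ} (hT : 0 ≤ T) (hx : x ∈ Icc 0 L) :
    φ T x ≤ M := by
  by_contra! hlt
  obtain ⟨η, hη, hηT⟩ : ∃ η > 0, M < φ T x - η * T := by
    refine ⟨(φ T x - M) / (T + 1), div_pos (by linarith) (by linarith), ?_⟩
    have : (φ T x - M) / (T + 1) * T < φ T x - M := by
      rw [div_mul_eq_mul_div, div_lt_iff₀ (by linarith)]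
      nlinarith
    linarith
  obtain ⟨p, hp, hmax⟩ := (isCompact_Icc.prod isCompact_Icc).exists_isMaxOn
    (f := fun p : ℝ × ℝ => φ p.1 p.2 - η * p.1) (s := Icc 0 T ×ˢ Icc 0 L)
    ⟨(T, x), ⟨hT, le_rfl⟩, hx⟩
    ((h.cont.mono (prod_mono Icc_subset_Ici_self subset_rfl)).sub (by fun_prop))
  obtain ⟨t₀, x₀⟩ := p
  obtain ⟨⟨ht₀, ht₀T⟩, hx₀⟩ := hp
  simp only at ht₀ ht₀T hx₀
  have hgt : M < φ t₀ x₀ - η * t₀ :=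
    hηT.trans_le (hmax (show (T, x) ∈ Icc 0 T ×ˢ Icc 0 L from ⟨⟨hT, le_rfl⟩, hx⟩))
  have hgt' : M < φ t₀ x₀ := hgt.trans_le (sub_le_self _ (by positivity))
  have ht₀pos : 0 < t₀ := by
    refine ht₀.lt_of_ne ?_
    rintro rfl
    exact (h0 x₀ hx₀).not_gt hgt'
  have hx₀I : x₀ ∈ Ioo 0 L := by
    refine ⟨hx₀.1.lt_of_ne ?_, hx₀.2.lt_of_ne ?_⟩
    · rintro rfl
      linarith [h.bc0 t₀ ht₀]
    · rintro rfl
      linarith [h.bcL t₀ ht₀]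
  have htime : η ≤ φt t₀ x₀ := by
    have hd : HasDerivAt (fun τ => φ τ x₀ - η * τ) (φt t₀ x₀ - η) t₀ := by
      simpa using (h.ht t₀ ht₀pos x₀ hx₀).fun_sub ((hasDerivAt_id t₀).const_mul η)
    have := hd.nonneg_of_forall_le_left ht₀pos fun τ hτ =>
      hmax (show (τ, x₀) ∈ Icc 0 T ×ˢ Icc 0 L from ⟨⟨hτ.1, hτ.2.trans ht₀T⟩, hx₀⟩)
    linarith
  have hspace : φxx t₀ x₀ ≤ 0 := by
    refine IsLocalMax.second_deriv_nonpos (f := φ t₀) (f' := φx t₀) (x₀ := x₀) ?_ ?_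
      ((h.hxx t₀ ht₀pos x₀ hx₀).hasDerivAt (Icc_mem_nhds hx₀I.1 hx₀I.2))
    · filter_upwards [Icc_mem_nhds hx₀I.1 hx₀I.2] with y hy
      have := hmax (show (t₀, y) ∈ Icc 0 T ×ˢ Icc 0 L from ⟨⟨ht₀, ht₀T⟩, hy⟩)
      simpa using this
    · filter_upwards [Ioo_mem_nhds hx₀I.1 hx₀I.2] with y hy
      exact (h.hx t₀ ht₀pos y (Ioo_subset_Icc_self hy)).hasDerivAt (Icc_mem_nhds hy.1 hy.2)
  linarith [h.pde t₀ ht₀pos x₀ hx₀I]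

theorem abs_le_of_initial_abs_le (h : IsDirichletHeatSol L φ φt φx φxx) {M : ℝ} (hM : 0 ≤ M)
    (h0 : ∀ x ∈ Icc 0 L, |φ 0 x| ≤ M) {T x : ℝ} (hT : 0 ≤ T) (hx : x ∈ Icc 0 L) :
    |φ T x| ≤ M := by
  have hneg := (h.const_mul (-1)).le_of_initial_le hM
    (fun y hy => by linarith [(abs_le.1 (h0 y hy)).1]) hT hx
  exact abs_le.2 ⟨by linarith, h.le_of_initial_le hM (fun y hy => (abs_le.1 (h0 y hy)).2) hT hx⟩

end IsDirichletHeatSol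

theorem integral_sin_mul_sin_of_sin_eq_zero {a b L : ℝ} (hab : a ^ 2 ≠ b ^ 2)
    (ha : Real.sin (a * L) = 0) (hb : Real.sin (b * L) = 0) :
    ∫ x in (0 : ℝ)..L, Real.sin (a * x) * Real.sin (b * x) = 0 := by
  have hne : b ^ 2 - a ^ 2 ≠ 0 := sub_ne_zero.2 hab.symm
  have hd : ∀ x ∈ uIcc 0 L, HasDerivAt
      (fun x => (a * Real.cos (a * x) * Real.sin (b * x)
        - b * Real.sin (a * x) * Real.cos (b * x)) / (b ^ 2 - a ^ 2))
      (Real.sin (a * x) * Real.sin (b * x)) x := by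
    intro x _
    have la := (hasDerivAt_id x).const_mul a
    have lb := (hasDerivAt_id x).const_mul b
    refine ((((la.cos.const_mul a).fun_mul lb.sin).fun_sub
      ((la.sin.const_mul b).fun_mul lb.cos)).div_const (b ^ 2 - a ^ 2)).congr_deriv ?_
    simp only [id]
    field_simp
    ring
  rw [intervalIntegral.integral_eq_sub_of_hasDerivAt hd
    (Continuous.intervalIntegrable (by fun_prop) _ _)]
  simp [ha, hb]

/-- Parseval's identity for finite sine sums. -/
theorem integral_sq_sum_sin {L : ℝ} (hL : 0 < L) (s : Finset ℕ) (c : ℕ → ℝ) :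
    ∫ x in (0 : ℝ)..L, (∑ n ∈ s, c n * Real.sin (n * Real.pi / L * x)) ^ 2 =
      ∑ n ∈ s, c n ^ 2 * ∫ x in (0 : ℝ)..L, Real.sin (n * Real.pi / L * x) ^ 2 := by
  have hsin : ∀ n : ℕ, Real.sin (n * Real.pi / L * L) = 0 := fun n => by
    rw [div_mul_cancel₀ _ hL.ne', Real.sin_nat_mul_pi]
  simp_rw [sq, Finset.sum_mul_sum]
  rw [intervalIntegral.integral_finsetSum
    fun i _ => Continuous.intervalIntegrable (by fun_prop) _ _]
  refine Finset.sum_congr rfl fun n hn => ?_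
  rw [intervalIntegral.integral_finsetSum
    fun i _ => Continuous.intervalIntegrable (by fun_prop) _ _]
  have hterm : ∀ m : ℕ, ∫ x in (0 : ℝ)..L, c n * Real.sin (n * Real.pi / L * x) *
      (c m * Real.sin (m * Real.pi / L * x)) = c n * c m *
        ∫ x in (0 : ℝ)..L, Real.sin (n * Real.pi / L * x) * Real.sin (m * Real.pi / L * x) := by
    intro m
    rw [← intervalIntegral.integral_const_mul]
    congr 1
    ext x
    ring
  simp_rw [hterm]
  refine Finset.sum_eq_single_of_mem n hn fun m _ hmn => ?_
  rw [integral_sin_mul_sin_of_sin_eq_zero _ (hsin n) (hsin m), mul_zero]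
  have hinj : (n : ℝ) * Real.pi / L ≠ m * Real.pi / L := by
    intro he
    rw [div_left_inj' hL.ne', mul_left_inj' Real.pi_ne_zero, Nat.cast_inj] at he
    exact hmn he.symm
  rwa [Ne, sq_eq_sq₀ (by positivity) (by positivity)]

/-- Finite sine sums are uniformly dense among the continuous functions on `[0, L]` that vanish
at both endpoints. -/
theorem exists_sum_sin_near {L : ℝ} (hL : 0 < L) {f : ℝ → ℝ} (hf : ContinuousOn f (Icc 0 L))
    (hf0 : f 0 = 0) (hfL : f L = 0) {ε : ℝ} (hε : 0 < ε) :
    ∃ (s : Finset ℕ) (c : ℕ → ℝ), ∀ x ∈ Icc 0 L,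
      |f x - ∑ n ∈ s, c n * Real.sin (n * Real.pi / L * x)| ≤ ε := by
  have : Fact (0 < 2 * L) := ⟨by positivity⟩
  let F : ℝ → ℝ := IccExtend hL.le (fun x : Icc 0 L => f x)
  have hF : Continuous F := hf.domRestrict.Icc_extend'
  have hFeq : ∀ x ∈ Icc 0 L, F x = f x := fun x hx => IccExtend_of_mem hL.le _ hx
  have hFneg : ∀ x ∈ Icc 0 L, F (-x) = 0 := fun x hx => by
    have : F (-x) = f 0 := IccExtend_of_le_left hL.le _ (by simpa using hx.1)
    rw [this, hf0]
  let g : ℝ → ℂ := fun x => ((F x - F (-x) : ℝ) : ℂ)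
  have hgpos : ∀ x ∈ Icc 0 L, g x = f x := fun x hx => by
    simp only [g, hFeq x hx, hFneg x hx, sub_zero]
  have hgneg : ∀ x ∈ Icc 0 L, g (-x) = ((-f x : ℝ) : ℂ) := fun x hx => by
    simp only [g, neg_neg, hFeq x hx, hFneg x hx, zero_sub]
  have hgend : g (-L) = g (-L + 2 * L) := by
    rw [show -L + 2 * L = L by ring, hgneg L ⟨hL.le, le_rfl⟩, hgpos L ⟨hL.le, le_rfl⟩, hfL,
      neg_zero]
  have hgc : Continuous g := by
    have : Continuous fun x => F x - F (-x) := by fun_prop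
    exact Complex.continuous_ofReal.comp this
  let G : C(AddCircle (2 * L), ℂ) :=
    ⟨AddCircle.liftIco (2 * L) (-L) g, AddCircle.liftIco_continuous hgend hgc.continuousOn⟩
  have hGg : ∀ x ∈ Icc (-L) L, G (x : AddCircle (2 * L)) = g x := by
    intro x hx
    rcases hx.2.lt_or_eq with hlt | rfl
    · exact AddCircle.liftIco_coe_apply (f := g)
        (show x ∈ Ico (-L) (-L + 2 * L) from ⟨hx.1, by linarith⟩)
    · have hcoe : ((x : ℝ) : AddCircle (2 * x)) = ((-x : ℝ) : AddCircle (2 * x)) := by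
        rw [← AddCircle.coe_add_period (2 * x) (-x)]
        congr 1
        ring
      rw [hcoe]
      refine (AddCircle.liftIco_coe_apply (f := g)
        (show -x ∈ Ico (-x) (-x + 2 * x) from ⟨le_rfl, by linarith⟩)).trans ?_
      rw [hgend]
      congr 1
      ring
  -- the odd real part of a trigonometric polynomial is a finite sine sum
  have hodd : ∀ p ∈ Submodule.span ℂ (range (fourier (T := 2 * L))),
      (fun x : ℝ => ((p (x : AddCircle (2 * L)) - p ((-x : ℝ) : AddCircle (2 * L))) / 2).re) ∈
        Submodule.span ℝ
          (range fun n : ℕ => fun x : ℝ => Real.sin (n * Real.pi / L * x)) := by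
    intro p hp
    obtain ⟨c, rfl⟩ := Finsupp.mem_span_range_iff_exists_finsupp.1 hp
    have hsum : (fun x : ℝ => (((c.sum fun i a => a • fourier i) (x : AddCircle (2 * L))
        - (c.sum fun i a => a • fourier i) ((-x : ℝ) : AddCircle (2 * L))) / 2 : ℂ).re) =
        ∑ i ∈ c.support, (-(c i).im) • fun x : ℝ => Real.sin ((i : ℝ) * Real.pi / L * x) := by
      ext x
      simp only [Finsupp.sum, ContinuousMap.coe_sum, Finset.sum_apply, ContinuousMap.coe_smul,
        Pi.smul_apply, smul_eq_mul, ← Finset.sum_sub_distrib, Finset.sum_div, Complex.re_sum]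
      refine Finset.sum_congr rfl fun i _ => ?_
      rw [fourier_coe_apply, fourier_coe_apply]
      have e1 : (2 * Real.pi * Complex.I * i * x / (2 * L : ℝ) : ℂ) =
          ((i * Real.pi / L * x : ℝ) : ℂ) * Complex.I := by
        push_cast
        field_simp
      have e2 : (2 * Real.pi * Complex.I * i * (-x : ℝ) / (2 * L : ℝ) : ℂ) =
          ((-(i * Real.pi / L * x) : ℝ) : ℂ) * Complex.I := by
        push_cast
        field_simp
      rw [e1, e2, Complex.exp_mul_I, Complex.exp_mul_I, ← Complex.ofReal_cos,
        ← Complex.ofReal_sin, ← Complex.ofReal_cos, ← Complex.ofReal_sin, Real.cos_neg,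
        Real.sin_neg]
      rw [Complex.ofReal_neg, show ∀ a u v : ℂ, (a * (u + v * Complex.I) -
        a * (u + -v * Complex.I)) / 2 = a * (v * Complex.I) by intros; ring]
      generalize (i : ℝ) * Real.pi / L * x = θ
      simp [Complex.sin_ofReal_re]
    rw [hsum]
    refine Submodule.sum_mem _ fun i _ => Submodule.smul_mem _ _ ?_
    obtain ⟨n, rfl | rfl⟩ := i.eq_nat_or_neg
    · exact Submodule.subset_span ⟨n, by simp⟩
    · have : (fun x : ℝ => Real.sin (((-(n : ℤ) : ℤ) : ℝ) * Real.pi / L * x)) =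
          -fun x : ℝ => Real.sin (n * Real.pi / L * x) := by
        ext x
        simp [neg_div]
      rw [this]
      exact Submodule.neg_mem _ (Submodule.subset_span ⟨n, rfl⟩)
  have hdense : G ∈ closure
      (Submodule.span ℂ (range (fourier (T := 2 * L))) : Set C(AddCircle (2 * L), ℂ)) := by
    rw [← Submodule.topologicalClosure_coe, span_fourier_closure_eq_top]
    trivial
  obtain ⟨p, hp, hGp⟩ := Metric.mem_closure_iff.1 hdense ε hε
  obtain ⟨c, hc⟩ := Finsupp.mem_span_range_iff_exists_finsupp.1 (hodd p hp)
  refine ⟨c.support, c, fun x hx => ?_⟩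
  have hval := congrFun hc x
  simp only [Finsupp.sum, Finset.sum_apply, Pi.smul_apply, smul_eq_mul] at hval
  rw [hval]
  have hnear : ∀ y ∈ Icc (-L) L, ‖g y - p (y : AddCircle (2 * L))‖ ≤ ε := fun y hy => by
    rw [← hGg y hy, ← dist_eq_norm]
    exact (ContinuousMap.dist_apply_le_dist _).trans hGp.le
  have h₁ := (Complex.abs_re_le_norm _).trans (hnear x ⟨by linarith [hx.1], hx.2⟩)
  have h₂ := (Complex.abs_re_le_norm _).trans
    (hnear (-x) ⟨by linarith [hx.2], by linarith [hx.1]⟩)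
  rw [hgpos x hx, Complex.sub_re, Complex.ofReal_re] at h₁
  rw [hgneg x hx, Complex.sub_re, Complex.ofReal_re] at h₂
  rw [Complex.div_ofNat_re, Complex.sub_re]
  rw [abs_le] at *
  constructor <;> linarith [h₁.1, h₁.2, h₂.1, h₂.2]

theorem exists_isDirichletHeatSol_sum_sin {L : ℝ} (hL : 0 < L) (s : Finset ℕ) (c : ℕ → ℝ) :
    ∃ ψt ψx ψxx, IsDirichletHeatSol L (fun t x => ∑ n ∈ s, c n *
      (Real.exp (-(n * Real.pi / L) ^ 2 * t) * Real.sin (n * Real.pi / L * x))) ψt ψx ψxx := by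
  induction s using Finset.induction_on with
  | empty => exact ⟨_, _, _, by simpa using IsDirichletHeatSol.zero⟩
  | insert n s hn ih =>
    obtain ⟨ψt, ψx, ψxx, h⟩ := ih
    have hk : Real.sin (n * Real.pi / L * L) = 0 := by
      rw [div_mul_cancel₀ _ hL.ne', Real.sin_nat_mul_pi]
    simp_rw [Finset.sum_insert hn]
    exact ⟨_, _, _, ((IsDirichletHeatSol.sineMode hk).const_mul (c n)).add h⟩

namespace IsDirichletHeatSol

variable {L : ℝ} {φ φt φx φxx : ℝ → ℝ → ℝ}

theorem integral_sq_le_initial (hL : 0 < L) (h : IsDirichletHeatSol L φ φt φx φxx) {T : ℝ}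
    (hT : 0 ≤ T) : ∫ x in (0 : ℝ)..L, φ T x ^ 2 ≤ ∫ x in (0 : ℝ)..L, φ 0 x ^ 2 := by
  obtain ⟨M, hM⟩ := isCompact_Icc.exists_bound_of_continuousOn (h.continuousOn_slice le_rfl)
  have hM0 : 0 ≤ M := (norm_nonneg _).trans (hM 0 ⟨le_rfl, hL.le⟩)
  have hint : ∀ t ≥ 0, IntervalIntegrable (fun x => φ t x ^ 2) volume 0 L := fun t ht =>
    ContinuousOn.intervalIntegrable_of_Icc hL.le ((h.continuousOn_slice ht).pow 2)
  have key : ∀ ε > 0, ∫ x in (0 : ℝ)..L, φ T x ^ 2 ≤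
      (∫ x in (0 : ℝ)..L, φ 0 x ^ 2) + 2 * (ε * (2 * M + ε)) * L := by
    intro ε hε
    obtain ⟨s, c, hsc⟩ := exists_sum_sin_near hL (h.continuousOn_slice le_rfl)
      (h.bc0 0 le_rfl) (h.bcL 0 le_rfl) hε
    obtain ⟨ψt, ψx, ψxx, hψ⟩ := exists_isDirichletHeatSol_sum_sin hL s c
    set ψ : ℝ → ℝ → ℝ := fun t x => ∑ n ∈ s, c n *
      (Real.exp (-(n * Real.pi / L) ^ 2 * t) * Real.sin (n * Real.pi / L * x)) with hψdef
    have hψint : ∀ t ≥ 0, IntervalIntegrable (fun x => ψ t x ^ 2) volume 0 L := fun t ht =>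
      ContinuousOn.intervalIntegrable_of_Icc hL.le ((hψ.continuousOn_slice ht).pow 2)
    have hclose : ∀ t ≥ 0, ∀ x ∈ Icc 0 L, |φ t x - ψ t x| ≤ ε := by
      intro t ht x hx
      have := (h.add (hψ.const_mul (-1))).abs_le_of_initial_abs_le hε.le (fun y hy => by
        have := hsc y hy
        simpa [hψdef, ← sub_eq_add_neg] using this) ht hx
      simpa [← sub_eq_add_neg] using this
    have hsq : ∀ t ≥ 0, ∀ x ∈ Icc 0 L, |φ t x ^ 2 - ψ t x ^ 2| ≤ ε * (2 * M + ε) := by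
      intro t ht x hx
      have hb := h.abs_le_of_initial_abs_le hM0 hM ht hx
      have hd := hclose t ht x hx
      rw [show φ t x ^ 2 - ψ t x ^ 2 =
        (φ t x - ψ t x) * (2 * φ t x - (φ t x - ψ t x)) by ring, abs_mul]
      refine mul_le_mul hd ((abs_sub _ _).trans ?_) (abs_nonneg _) hε.le
      rw [abs_mul, abs_two]
      linarith
    have hconst : ∀ f g : ℝ → ℝ, IntervalIntegrable f volume 0 L →
        IntervalIntegrable g volume 0 L → (∀ x ∈ Icc 0 L, f x ≤ g x + ε * (2 * M + ε)) →
        ∫ x in (0 : ℝ)..L, f x ≤ (∫ x in (0 : ℝ)..L, g x) + ε * (2 * M + ε) * L := by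
      intro f g hf hg hfg
      have := intervalIntegral.integral_mono_on hL.le hf (hg.add intervalIntegrable_const) hfg
      rwa [intervalIntegral.integral_add hg intervalIntegrable_const,
        intervalIntegral.integral_const, sub_zero, smul_eq_mul, mul_comm L] at this
    have h₁ := hconst _ _ (hint T hT) (hψint T hT) fun x hx => by
      linarith [(abs_le.1 (hsq T hT x hx)).2]
    have h₂ := hconst _ _ (hψint 0 le_rfl) (hint 0 le_rfl) fun x hx => by
      linarith [(abs_le.1 (hsq 0 le_rfl x hx)).1]
    have h₃ : ∫ x in (0 : ℝ)..L, ψ T x ^ 2 ≤ ∫ x in (0 : ℝ)..L, ψ 0 x ^ 2 := by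
      simp only [hψdef, ← mul_assoc]
      rw [integral_sq_sum_sin hL, integral_sq_sum_sin hL]
      refine Finset.sum_le_sum fun n _ => ?_
      refine mul_le_mul_of_nonneg_right ?_
        (intervalIntegral.integral_nonneg hL.le fun x _ => sq_nonneg _)
      rw [mul_pow, mul_pow, mul_zero, Real.exp_zero, one_pow]
      refine mul_le_mul_of_nonneg_left (pow_le_one₀ (Real.exp_nonneg _) ?_) (sq_nonneg _)
      refine Real.exp_le_one_iff.2 ?_
      rw [neg_mul]
      exact neg_nonpos.2 (by positivity)
    linarith
  have hlim : Tendsto (fun ε : ℝ => (∫ x in (0 : ℝ)..L, φ 0 x ^ 2) + 2 * (ε * (2 * M + ε)) * L)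
      (𝓝[>] 0) (𝓝 (∫ x in (0 : ℝ)..L, φ 0 x ^ 2)) := by
    refine Tendsto.mono_left ?_ nhdsWithin_le_nhds
    have : Continuous fun ε : ℝ =>
        (∫ x in (0 : ℝ)..L, φ 0 x ^ 2) + 2 * (ε * (2 * M + ε)) * L := by fun_prop
    simpa using this.tendsto 0
  exact ge_of_tendsto hlim (eventually_mem_nhdsWithin.mono key)

/-- The `L²` norm of a Dirichlet heat solution is nonincreasing in time. -/
theorem integral_sq_anti (hL : 0 < L) (h : IsDirichletHeatSol L φ φt φx φxx) {s t : ℝ}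
    (hs : 0 ≤ s) (hst : s ≤ t) :
    ∫ x in (0 : ℝ)..L, φ t x ^ 2 ≤ ∫ x in (0 : ℝ)..L, φ s x ^ 2 := by
  simpa using (h.shift hs).integral_sq_le_initial hL (sub_nonneg.2 hst)

/-- Dissipation bounds the energy at time `T` by the weighted space-time integral. -/
theorem integral_sq_le_weighted (hL : 0 < L) (h : IsDirichletHeatSol L φ φt φx φxx)
    (hint : IntegrableOn
      (fun t => ∫ x in (0 : ℝ)..L, Real.exp (-L ^ 2 / (2 * t)) * (φ t x) ^ 2) (Ioi 0))
    {s T : ℝ} (hs : 0 < s) (hsT : s ≤ T) :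
    (T - s) * (Real.exp (-L ^ 2 / (2 * s)) * ∫ x in (0 : ℝ)..L, φ T x ^ 2) ≤
      ∫ t in Ioi (0 : ℝ), ∫ x in (0 : ℝ)..L, Real.exp (-L ^ 2 / (2 * t)) * (φ t x) ^ 2 := by
  have hE : ∀ t, 0 ≤ ∫ x in (0 : ℝ)..L, φ t x ^ 2 := fun t =>
    intervalIntegral.integral_nonneg hL.le fun x _ => sq_nonneg _
  have hsub : Ioc s T ⊆ Ioi 0 := fun t ht => hs.trans ht.1
  have hmono := setIntegral_mono_set hint (Eventually.of_forall fun t =>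
    intervalIntegral.integral_nonneg hL.le fun x _ => by positivity) hsub.eventuallyLE
  refine le_trans ?_ hmono
  have hconst := setIntegral_mono_on (μ := volume) (s := Ioc s T)
    (f := fun _ => Real.exp (-L ^ 2 / (2 * s)) * ∫ x in (0 : ℝ)..L, φ T x ^ 2)
    (integrableOn_const (by simp)) (hint.mono_set hsub) measurableSet_Ioc fun t ht => by
      rw [intervalIntegral.integral_const_mul]
      refine mul_le_mul (Real.exp_le_exp.2 ?_)
        (h.integral_sq_anti hL (hs.trans ht.1).le ht.2) (hE T) (Real.exp_nonneg _)
      rw [neg_div, neg_div, neg_le_neg_iff]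
      have := ht.1.le
      gcongr
  simpa [setIntegral_const, hsT] using hconst

end IsDirichletHeatSol

end HeatSolutions

/-- Let `L > 0`.  Assume hypothesis (H) (Conjecture 2 of the paper): for
every `δ > 0` there exist `C_δ > 0` and `T_δ > 0` such that for every `T ∈ (0,T_δ)` and
every Dirichlet heat solution `φ` on `[0,∞)` (with all integrals finite)
`∫_0^∞ ∫_0^L e^{-L²/(2t)} φ(t,x)² dx dt ≤ C_δ e^{δ/T} ∫_0^T (∂_x φ(t,0))² dt`.
Then for every `K > L²/4` there exist `C(K) > 0` and `T₀ > 0` such that for every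
`T ∈ (0,T₀)` and every Dirichlet heat solution `φ` on `[0,∞)` (with all integrals finite)
`∫_0^L φ(T,x)² dx ≤ C(K) e^{2K/T} ∫_0^T (∂_x φ(t,0))² dt`  (Proposition 1 of the paper). -/
theorem weighted_obs_implies_fast_control_obs
    (L : ℝ) (hL : 0 < L)
    (H : ∀ δ > (0 : ℝ), ∃ Cδ > (0 : ℝ), ∃ Tδ > (0 : ℝ),
      ∀ T ∈ Set.Ioo (0 : ℝ) Tδ, ∀ φ φt φx φxx : ℝ → ℝ → ℝ,
        IsDirichletHeatSol L φ φt φx φxx →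
        IntegrableOn
          (fun t => ∫ x in (0 : ℝ)..L, Real.exp (-L ^ 2 / (2 * t)) * (φ t x) ^ 2)
          (Set.Ioi 0) →
        IntervalIntegrable (fun t => (φx t 0) ^ 2) volume 0 T →
        (∫ t in Set.Ioi (0 : ℝ),
            ∫ x in (0 : ℝ)..L, Real.exp (-L ^ 2 / (2 * t)) * (φ t x) ^ 2) ≤
          Cδ * Real.exp (δ / T) * ∫ t in (0 : ℝ)..T, (φx t 0) ^ 2) :
    ∀ K > L ^ 2 / 4, ∃ C > (0 : ℝ), ∃ T₀ > (0 : ℝ),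
      ∀ T ∈ Set.Ioo (0 : ℝ) T₀, ∀ φ φt φx φxx : ℝ → ℝ → ℝ,
        IsDirichletHeatSol L φ φt φx φxx →
        IntegrableOn
          (fun t => ∫ x in (0 : ℝ)..L, Real.exp (-L ^ 2 / (2 * t)) * (φ t x) ^ 2)
          (Set.Ioi 0) →
        IntervalIntegrable (fun t => (φx t 0) ^ 2) volume 0 T →
        (∫ x in (0 : ℝ)..L, (φ T x) ^ 2) ≤
          C * Real.exp (2 * K / T) * ∫ t in (0 : ℝ)..T, (φx t 0) ^ 2 := by
  intro K hK
  obtain ⟨d, hd, rfl⟩ : ∃ d > 0, K = L ^ 2 / 4 + d := ⟨K - L ^ 2 / 4, by linarith, by ring⟩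
  obtain ⟨Cδ, hCδ, Tδ, hTδ, hH⟩ := H (d / 2) (by positivity)
  refine ⟨Cδ * ((L ^ 2 + 2 * d) / d ^ 2), by positivity, Tδ, hTδ, ?_⟩
  intro T hT φ φt φx φxx hφ hint hflux
  have hT0 : 0 < T := hT.1
  have hobs := hH T hT φ φt φx φxx hφ hint hflux
  set I := ∫ t in (0 : ℝ)..T, (φx t 0) ^ 2
  set E := ∫ x in (0 : ℝ)..L, (φ T x) ^ 2
  have hI : 0 ≤ I := intervalIntegral.integral_nonneg hT0.le fun t _ => sq_nonneg _
  have hs : 0 < L ^ 2 / (L ^ 2 + 2 * d) * T := by positivity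
  have hsT : L ^ 2 / (L ^ 2 + 2 * d) * T ≤ T :=
    mul_le_of_le_one_left hT0.le ((div_le_one (by positivity)).2 (by linarith))
  have hlow := (hφ.integral_sq_le_weighted hL hint hs hsT).trans hobs
  have hgap : T - L ^ 2 / (L ^ 2 + 2 * d) * T = 2 * d / (L ^ 2 + 2 * d) * T := by
    field_simp
    ring
  have hexp : -L ^ 2 / (2 * (L ^ 2 / (L ^ 2 + 2 * d) * T)) = -((L ^ 2 / 2 + d) / T) := by
    field_simp
  rw [hgap, hexp, Real.exp_neg] at hlow
  have hlin : d / 2 / T ≤ Real.exp (d / 2 / T) := by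
    linarith [Real.add_one_le_exp (d / 2 / T)]
  have hsplit : Real.exp (2 * (L ^ 2 / 4 + d) / T) =
      Real.exp ((L ^ 2 / 2 + d) / T) * Real.exp (d / 2 / T) * Real.exp (d / 2 / T) := by
    rw [← Real.exp_add, ← Real.exp_add]
    congr 1
    ring
  rw [hsplit]
  calc E = (L ^ 2 + 2 * d) / (2 * d * T) * Real.exp ((L ^ 2 / 2 + d) / T) *
        (2 * d / (L ^ 2 + 2 * d) * T * ((Real.exp ((L ^ 2 / 2 + d) / T))⁻¹ * E)) := by
        field_simp
    _ ≤ (L ^ 2 + 2 * d) / (2 * d * T) * Real.exp ((L ^ 2 / 2 + d) / T) *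
        (Cδ * Real.exp (d / 2 / T) * I) := by gcongr
    _ = Cδ * ((L ^ 2 + 2 * d) / d ^ 2) * (Real.exp ((L ^ 2 / 2 + d) / T) *
        Real.exp (d / 2 / T) * (d / 2 / T)) * I := by
        field_simp
    _ ≤ _ := by gcongr
end

section
/- Let L>0, M∈ℝ, ε∈(0,1), T>0, a∈(0,1), b∈(0,1], and C>0. Let ψ be an adjoint transport-diffusion solution, and define φ(t,x) := e^{M²t/(4ε²)+Mx/(2ε)}·ψ(t/ε,x) for (t,x)∈(0,∞)×[0,L]. Assume ∫_0^∞∫_0^L e^{-L²/(2t)} φ(t,x)² dx dt ≤ C·∫_0^{bεT} (∂_xφ(t,0))² dt, with all integrals finite. Then (1-a)·T·e^{-L²/(2aεT) + M²T/(2ε)}·∫_0^L e^{Mx/ε}·ψ(T,x)² dx ≤ C·e^{bM²T/(2ε)}·∫_0^{bT} (∂_xψ(t,0))² dt. -/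
open MeasureTheory

/-- An "adjoint transport-diffusion solution" for parameters `L, M, ε`:
`ψ : [0,∞) × [0,L] → ℝ` continuous, `C¹` in `t` and `C²` in `x` on `(0,∞) × [0,L]`,
with `∂_t ψ - ε ∂_{xx} ψ - M ∂_x ψ = 0` for `t > 0`, `x ∈ (0,L)`, and
`ψ(t,0) = ψ(t,L) = 0` for all `t ≥ 0`.  The derivatives are the data `ψt`, `ψx`, `ψxx`. -/
structure IsAdjointTDSol (L M ε : ℝ) (ψ ψt ψx ψxx : ℝ → ℝ → ℝ) : Prop where
  cont : ContinuousOn (fun p : ℝ × ℝ => ψ p.1 p.2) (Set.Ici 0 ×ˢ Set.Icc 0 L)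
  ht : ∀ t > (0 : ℝ), ∀ x ∈ Set.Icc (0 : ℝ) L,
    HasDerivAt (fun τ => ψ τ x) (ψt t x) t
  htc : ∀ x ∈ Set.Icc (0 : ℝ) L, ContinuousOn (fun t => ψt t x) (Set.Ioi 0)
  hx : ∀ t > (0 : ℝ), ∀ x ∈ Set.Icc (0 : ℝ) L,
    HasDerivWithinAt (fun ξ => ψ t ξ) (ψx t x) (Set.Icc 0 L) x
  hxc : ∀ t > (0 : ℝ), ContinuousOn (fun x => ψx t x) (Set.Icc 0 L)
  hxx : ∀ t > (0 : ℝ), ∀ x ∈ Set.Icc (0 : ℝ) L,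
    HasDerivWithinAt (fun ξ => ψx t ξ) (ψxx t x) (Set.Icc 0 L) x
  hxxc : ∀ t > (0 : ℝ), ContinuousOn (fun x => ψxx t x) (Set.Icc 0 L)
  pde : ∀ t > (0 : ℝ), ∀ x ∈ Set.Ioo (0 : ℝ) L,
    ψt t x - ε * ψxx t x - M * ψx t x = 0
  bc0 : ∀ t ≥ (0 : ℝ), ψ t 0 = 0
  bcL : ∀ t ≥ (0 : ℝ), ψ t L = 0

/-- Classical solutions of `∂_t u = κ ∂_{xx} u` on `(0,∞) × (0,L)`, continuous up to the parabolic
boundary and vanishing at `x = 0` and `x = L`. -/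
structure IsDirichletHeatSol_s6 (κ L : ℝ) (u ut ux uxx : ℝ → ℝ → ℝ) : Prop where
  cont : ContinuousOn (fun p : ℝ × ℝ => u p.1 p.2) (Set.Ici 0 ×ˢ Set.Icc 0 L)
  ht : ∀ t > (0 : ℝ), ∀ x ∈ Set.Ioo (0 : ℝ) L, HasDerivAt (fun τ => u τ x) (ut t x) t
  hx : ∀ t > (0 : ℝ), ∀ x ∈ Set.Ioo (0 : ℝ) L, HasDerivAt (u t) (ux t x) x
  hxx : ∀ t > (0 : ℝ), ∀ x ∈ Set.Ioo (0 : ℝ) L, HasDerivAt (ux t) (uxx t x) x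
  heat : ∀ t > (0 : ℝ), ∀ x ∈ Set.Ioo (0 : ℝ) L, ut t x = κ * uxx t x
  bc0 : ∀ t ≥ (0 : ℝ), u t 0 = 0
  bcL : ∀ t ≥ (0 : ℝ), u t L = 0

/-- Solutions of `∂_t u = κ ∂_{xx} u` on the whole plane with jointly continuous derivatives,
vanishing at `x = 0` and `x = L`. -/
structure IsRegularDirichletHeatSol (κ L : ℝ) (u ut ux uxx : ℝ → ℝ → ℝ) : Prop where
  cont : Continuous fun p : ℝ × ℝ => u p.1 p.2
  cont_t : Continuous fun p : ℝ × ℝ => ut p.1 p.2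
  cont_x : Continuous fun p : ℝ × ℝ => ux p.1 p.2
  cont_xx : Continuous fun p : ℝ × ℝ => uxx p.1 p.2
  ht : ∀ t x, HasDerivAt (fun τ => u τ x) (ut t x) t
  hx : ∀ t x, HasDerivAt (u t) (ux t x) x
  hxx : ∀ t x, HasDerivAt (ux t) (uxx t x) x
  heat : ∀ t x, ut t x = κ * uxx t x
  bc0 : ∀ t, u t 0 = 0
  bcL : ∀ t, u t L = 0

theorem not_isLocalMax_of_hasDerivAt_of_pos {f f' : ℝ → ℝ} {x₀ c : ℝ}
    (hf : ∀ᶠ x in nhds x₀, HasDerivAt f (f' x) x) (hf' : HasDerivAt f' c x₀) (hc : 0 < c) :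
    ¬ IsLocalMax f x₀ := by
  intro hmax
  have hd : deriv f =ᶠ[nhds x₀] f' := hf.mono fun x hx => hx.deriv
  have hdd : deriv (deriv f) x₀ = c := by rw [hd.deriv_eq, hf'.deriv]
  have hmin : IsLocalMin f x₀ :=
    isLocalMin_of_deriv_deriv_pos (by rw [hdd]; exact hc) hmax.deriv_eq_zero
      hf.self_of_nhds.continuousAt
  have hconst : f =ᶠ[nhds x₀] fun _ => f x₀ := by
    filter_upwards [hmax, hmin] with x h1 h2 using le_antisymm h1 h2
  have h0 : deriv f =ᶠ[nhds x₀] fun _ => 0 := by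
    filter_upwards [hconst.deriv] with x hx
    rw [hx, deriv_const]
  have h00 := h0.deriv_eq
  rw [hdd, deriv_const] at h00
  exact hc.ne' h00

theorem HasDerivAt.nonneg_of_isMaxOn_left {f : ℝ → ℝ} {a t d : ℝ} (hf : HasDerivAt f d t)
    (hat : a < t) (hmax : ∀ s ∈ Set.Icc a t, f s ≤ f t) : 0 ≤ d := by
  have h1 : Filter.Tendsto (slope f t) (nhdsWithin t (Set.Iio t)) (nhds d) :=
    (hasDerivAt_iff_tendsto_slope.1 hf).mono_left
      (nhdsWithin_mono _ fun y hy => ne_of_lt hy)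
  refine ge_of_tendsto h1 ?_
  filter_upwards [Ioo_mem_nhdsLT hat] with s hs
  rw [slope_def_field]
  exact div_nonneg_of_nonpos (sub_nonpos.2 (hmax s ⟨hs.1.le, hs.2.le⟩)) (sub_nonpos.2 hs.2.le)

namespace IsDirichletHeatSol_s6

variable {κ L : ℝ} {u ut ux uxx v vt vx vxx : ℝ → ℝ → ℝ}

theorem sub (hu : IsDirichletHeatSol_s6 κ L u ut ux uxx) (hv : IsDirichletHeatSol_s6 κ L v vt vx vxx) :
    IsDirichletHeatSol_s6 κ L (fun t x => u t x - v t x) (fun t x => ut t x - vt t x)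
      (fun t x => ux t x - vx t x) (fun t x => uxx t x - vxx t x) where
  cont := hu.cont.sub hv.cont
  ht t h x hx := (hu.ht t h x hx).sub (hv.ht t h x hx)
  hx t h x hx := (hu.hx t h x hx).sub (hv.hx t h x hx)
  hxx t h x hx := (hu.hxx t h x hx).sub (hv.hxx t h x hx)
  heat t h x hx := by rw [hu.heat t h x hx, hv.heat t h x hx]; ring
  bc0 t h := by rw [hu.bc0 t h, hv.bc0 t h, sub_zero]
  bcL t h := by rw [hu.bcL t h, hv.bcL t h, sub_zero]

/-- Weak maximum principle. -/
theorem le_of_initial_le_s6 (hκ : 0 < κ) (hu : IsDirichletHeatSol_s6 κ L u ut ux uxx) {m : ℝ}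
    (hm : 0 ≤ m) (h0 : ∀ x ∈ Set.Icc 0 L, u 0 x ≤ m) {t x : ℝ} (ht : 0 ≤ t)
    (hx : x ∈ Set.Icc 0 L) : u t x ≤ m := by
  have key : ∀ η > 0, u t x - η * t ≤ m := by
    intro η hη
    have hcont : ContinuousOn (fun p : ℝ × ℝ => u p.1 p.2 - η * p.1)
        (Set.Icc 0 t ×ˢ Set.Icc 0 L) :=
      (hu.cont.mono (Set.prod_mono Set.Icc_subset_Ici_self subset_rfl)).sub (by fun_prop)
    obtain ⟨⟨s, y⟩, ⟨hs, hy⟩, hmax⟩ := (isCompact_Icc.prod isCompact_Icc).exists_isMaxOn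
      ⟨(t, x), ⟨ht, le_rfl⟩, hx⟩ hcont
    dsimp only at hs hy
    have hmax' : ∀ τ ∈ Set.Icc 0 t, ∀ ξ ∈ Set.Icc 0 L, u τ ξ - η * τ ≤ u s y - η * s :=
      fun τ hτ ξ hξ => hmax (show (τ, ξ) ∈ Set.Icc 0 t ×ˢ Set.Icc 0 L from ⟨hτ, hξ⟩)
    refine (hmax' t ⟨ht, le_rfl⟩ x hx).trans ?_
    have hηs : 0 ≤ η * s := mul_nonneg hη.le hs.1
    rcases hs.1.eq_or_lt with h | hs0
    · subst h
      linarith [h0 y hy]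
    rcases hy.1.eq_or_lt with h | hy0
    · subst h
      linarith [hu.bc0 s hs.1]
    rcases hy.2.eq_or_lt with h | hyL
    · subst h
      linarith [hu.bcL s hs.1]
    exfalso
    have hyI : y ∈ Set.Ioo 0 L := ⟨hy0, hyL⟩
    have hnn : 0 ≤ ut s y - η := by
      have hd : HasDerivAt (fun τ => u τ y - η * τ) (ut s y - η * 1) s :=
        (hu.ht s hs0 y hyI).sub ((hasDerivAt_id s).const_mul η)
      have := hd.nonneg_of_isMaxOn_left hs0
        fun τ hτ => hmax' τ ⟨hτ.1, hτ.2.trans hs.2⟩ y hy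
      linarith
    have hpos : 0 < uxx s y := by
      have h1 : 0 < κ * uxx s y := by linarith [hu.heat s hs0 y hyI]
      exact pos_of_mul_pos_right h1 hκ.le
    refine not_isLocalMax_of_hasDerivAt_of_pos (f := u s) ?_ (hu.hxx s hs0 y hyI) hpos ?_
    · filter_upwards [Ioo_mem_nhds hy0 hyL] with ξ hξ using hu.hx s hs0 ξ hξ
    · filter_upwards [Ioo_mem_nhds hy0 hyL] with ξ hξ
      linarith [hmax' s hs ξ ⟨hξ.1.le, hξ.2.le⟩]
  refine le_of_forall_pos_le_add fun δ hδ => ?_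
  have h1 := key (δ / (t + 1)) (by positivity)
  have h2 : δ / (t + 1) * t ≤ δ := by
    rw [div_mul_eq_mul_div, div_le_iff₀ (by positivity)]
    nlinarith
  linarith

theorem abs_sub_le (hκ : 0 < κ) (hu : IsDirichletHeatSol_s6 κ L u ut ux uxx)
    (hv : IsDirichletHeatSol_s6 κ L v vt vx vxx) {m : ℝ}
    (hm : 0 ≤ m) (h0 : ∀ x ∈ Set.Icc 0 L, |u 0 x - v 0 x| ≤ m) {t x : ℝ} (ht : 0 ≤ t)
    (hx : x ∈ Set.Icc 0 L) : |u t x - v t x| ≤ m := by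
  refine abs_sub_le_iff.2 ⟨?_, ?_⟩
  · exact (hu.sub hv).le_of_initial_le_s6 hκ hm (fun y hy => (abs_sub_le_iff.1 (h0 y hy)).1) ht hx
  · exact (hv.sub hu).le_of_initial_le_s6 hκ hm (fun y hy => (abs_sub_le_iff.1 (h0 y hy)).2) ht hx

end IsDirichletHeatSol_s6

namespace IsRegularDirichletHeatSol

variable {κ L : ℝ} {u ut ux uxx v vt vx vxx : ℝ → ℝ → ℝ}

theorem isDirichletHeatSol (hu : IsRegularDirichletHeatSol κ L u ut ux uxx) :
    IsDirichletHeatSol_s6 κ L u ut ux uxx where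
  cont := hu.cont.continuousOn
  ht t _ x _ := hu.ht t x
  hx t _ x _ := hu.hx t x
  hxx t _ x _ := hu.hxx t x
  heat t _ x _ := hu.heat t x
  bc0 t _ := hu.bc0 t
  bcL t _ := hu.bcL t

theorem zero : IsRegularDirichletHeatSol κ L (fun _ _ => 0) (fun _ _ => 0) (fun _ _ => 0)
    (fun _ _ => 0) where
  cont := continuous_const
  cont_t := continuous_const
  cont_x := continuous_const
  cont_xx := continuous_const
  ht t x := hasDerivAt_const t 0
  hx t x := hasDerivAt_const x 0
  hxx t x := hasDerivAt_const x 0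
  heat t x := by simp
  bc0 t := rfl
  bcL t := rfl

theorem add (hu : IsRegularDirichletHeatSol κ L u ut ux uxx)
    (hv : IsRegularDirichletHeatSol κ L v vt vx vxx) :
    IsRegularDirichletHeatSol κ L (fun t x => u t x + v t x) (fun t x => ut t x + vt t x)
      (fun t x => ux t x + vx t x) (fun t x => uxx t x + vxx t x) where
  cont := hu.cont.add hv.cont
  cont_t := hu.cont_t.add hv.cont_t
  cont_x := hu.cont_x.add hv.cont_x
  cont_xx := hu.cont_xx.add hv.cont_xx
  ht t x := (hu.ht t x).add (hv.ht t x)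
  hx t x := (hu.hx t x).add (hv.hx t x)
  hxx t x := (hu.hxx t x).add (hv.hxx t x)
  heat t x := by rw [hu.heat, hv.heat]; ring
  bc0 t := by rw [hu.bc0, hv.bc0, add_zero]
  bcL t := by rw [hu.bcL, hv.bcL, add_zero]

theorem sineMode (hL : L ≠ 0) (c : ℝ) (n : ℤ) :
    IsRegularDirichletHeatSol κ L
      (fun t x => c *
        (Real.exp (-(κ * (n * Real.pi / L) ^ 2) * t) * Real.sin (n * Real.pi / L * x)))
      (fun t x => c * (-(κ * (n * Real.pi / L) ^ 2) *
        (Real.exp (-(κ * (n * Real.pi / L) ^ 2) * t) * Real.sin (n * Real.pi / L * x))))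
      (fun t x => c * (n * Real.pi / L *
        (Real.exp (-(κ * (n * Real.pi / L) ^ 2) * t) * Real.cos (n * Real.pi / L * x))))
      (fun t x => c * (-(n * Real.pi / L) ^ 2 *
        (Real.exp (-(κ * (n * Real.pi / L) ^ 2) * t) * Real.sin (n * Real.pi / L * x)))) where
  cont := by fun_prop
  cont_t := by fun_prop
  cont_x := by fun_prop
  cont_xx := by fun_prop
  ht t x := by
    have h := (((hasDerivAt_id t).const_mul (-(κ * (n * Real.pi / L) ^ 2))).exp.mul_const
      (Real.sin (n * Real.pi / L * x))).const_mul c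
    refine h.congr_deriv ?_
    simp only [id]; ring
  hx t x := by
    have h := ((((hasDerivAt_id x).const_mul (n * Real.pi / L)).sin.const_mul
      (Real.exp (-(κ * (n * Real.pi / L) ^ 2) * t)))).const_mul c
    refine h.congr_deriv ?_
    simp only [id]; ring
  hxx t x := by
    have h := (((((hasDerivAt_id x).const_mul (n * Real.pi / L)).cos.const_mul
      (Real.exp (-(κ * (n * Real.pi / L) ^ 2) * t)))).const_mul (n * Real.pi / L)).const_mul c
    refine h.congr_deriv ?_
    simp only [id]; ring
  heat t x := by ring
  bc0 t := by simp
  bcL t := by simp [div_mul_cancel₀ _ hL, Real.sin_int_mul_pi]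

theorem antitone_integral_sq (hκ : 0 ≤ κ) (hL : 0 ≤ L)
    (hu : IsRegularDirichletHeatSol κ L u ut ux uxx) :
    Antitone fun t => ∫ x in (0 : ℝ)..L, u t x ^ 2 := by
  have hsec : ∀ {w : ℝ → ℝ → ℝ}, (Continuous fun p : ℝ × ℝ => w p.1 p.2) → ∀ t,
      Continuous (w t) := fun hw t => hw.comp (Continuous.prodMk_right t)
  have hderiv : ∀ t, HasDerivAt (fun t => ∫ x in (0 : ℝ)..L, u t x ^ 2)
      (∫ x in (0 : ℝ)..L, 2 * u t x * ut t x) t := by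
    intro t
    have hc : Continuous fun p : ℝ × ℝ => 2 * u p.1 p.2 * ut p.1 p.2 :=
      (continuous_const.mul hu.cont).mul hu.cont_t
    obtain ⟨B, hB⟩ := ((isCompact_Icc (a := t - 1) (b := t + 1)).prod
      (isCompact_Icc (a := (0 : ℝ)) (b := L))).exists_bound_of_continuousOn hc.continuousOn
    refine (intervalIntegral.hasDerivAt_integral_of_dominated_loc_of_deriv_le
      (F' := fun t x => 2 * u t x * ut t x) (bound := fun _ => B)
      (Icc_mem_nhds (show t - 1 < t by linarith) (show t < t + 1 by linarith))
      (Filter.Eventually.of_forall fun s => ((hsec hu.cont s).pow 2).aestronglyMeasurable)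
      (((hsec hu.cont t).pow 2).intervalIntegrable _ _)
      (hc.comp (Continuous.prodMk_right t)).aestronglyMeasurable ?_ intervalIntegrable_const ?_).2
    · refine Filter.Eventually.of_forall fun x hx s hs => ?_
      rw [Set.uIoc_of_le hL] at hx
      exact hB (s, x) ⟨hs, hx.1.le, hx.2⟩
    · refine Filter.Eventually.of_forall fun x hx s hs => ?_
      simpa using (hu.ht s x).fun_pow 2
  refine antitone_of_deriv_nonpos (fun t => (hderiv t).differentiableAt) fun t => ?_
  rw [(hderiv t).deriv]
  have hibp : ∫ x in (0 : ℝ)..L, u t x * uxx t x = - ∫ x in (0 : ℝ)..L, ux t x * ux t x := by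
    rw [intervalIntegral.integral_mul_deriv_eq_deriv_mul (fun x _ => hu.hx t x)
      (fun x _ => hu.hxx t x) ((hsec hu.cont_x t).intervalIntegrable _ _)
      ((hsec hu.cont_xx t).intervalIntegrable _ _), hu.bc0, hu.bcL]
    ring
  have heq : ∫ x in (0 : ℝ)..L, 2 * u t x * ut t x
      = 2 * κ * ∫ x in (0 : ℝ)..L, u t x * uxx t x := by
    rw [← intervalIntegral.integral_const_mul]
    refine intervalIntegral.integral_congr fun x _ => ?_
    simp only [hu.heat]; ring
  rw [heq, hibp]
  have : 0 ≤ ∫ x in (0 : ℝ)..L, ux t x * ux t x :=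
    intervalIntegral.integral_nonneg hL fun x _ => mul_self_nonneg _
  nlinarith [mul_nonneg hκ this]

end IsRegularDirichletHeatSol

theorem exists_regularDirichletHeatSol_of_mem_span_fourier (κ : ℝ) {L : ℝ} (hL : L ≠ 0)
    {p : C(AddCircle (2 * L), ℂ)}
    (hp : p ∈ Submodule.span ℂ (Set.range (@fourier (2 * L)))) :
    ∃ u ut ux uxx, IsRegularDirichletHeatSol κ L u ut ux uxx ∧
      ∀ x : ℝ, u 0 x = (p (x : AddCircle (2 * L)) - p ((-x : ℝ) : AddCircle (2 * L))).re / 2 := by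
  suffices h : ∀ c : ℂ, ∃ u ut ux uxx, IsRegularDirichletHeatSol κ L u ut ux uxx ∧
      ∀ x : ℝ, u 0 x =
        (c * (p (x : AddCircle (2 * L)) - p ((-x : ℝ) : AddCircle (2 * L)))).re / 2 by
    simpa using h 1
  induction hp using Submodule.span_induction with
  | mem p hp =>
    obtain ⟨n, rfl⟩ := hp
    intro c
    refine ⟨_, _, _, _, IsRegularDirichletHeatSol.sineMode hL (-c.im) n, fun x => ?_⟩
    have harg : ∀ y : ℝ, 2 * (Real.pi : ℂ) * Complex.I * n * y / ((2 * L : ℝ) : ℂ)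
        = ((n * Real.pi / L * y : ℝ) : ℂ) * Complex.I := by
      intro y
      have : (L : ℂ) ≠ 0 := by exact_mod_cast hL
      push_cast
      field_simp
    rw [fourier_coe_apply, fourier_coe_apply, harg, harg, Complex.exp_mul_I, Complex.exp_mul_I,
      ← Complex.ofReal_cos, ← Complex.ofReal_sin, ← Complex.ofReal_cos, ← Complex.ofReal_sin,
      mul_neg, Real.cos_neg, Real.sin_neg]
    simp [-Complex.ofReal_cos, -Complex.ofReal_sin]
    ring
  | zero => exact fun c => ⟨_, _, _, _, IsRegularDirichletHeatSol.zero, fun x => by simp⟩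
  | add p q _ _ hp hq =>
    intro c
    obtain ⟨u, ut, ux, uxx, hu, hu0⟩ := hp c
    obtain ⟨v, vt, vx, vxx, hv, hv0⟩ := hq c
    refine ⟨_, _, _, _, hu.add hv, fun x => ?_⟩
    rw [hu0, hv0, ← add_div, ← Complex.add_re, ContinuousMap.add_apply, ContinuousMap.add_apply]
    congr 2
    ring
  | smul a p _ hp =>
    intro c
    obtain ⟨u, ut, ux, uxx, hu, hu0⟩ := hp (c * a)
    refine ⟨_, _, _, _, hu, fun x => ?_⟩
    rw [hu0, ContinuousMap.smul_apply, ContinuousMap.smul_apply, smul_eq_mul, smul_eq_mul]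
    congr 2
    ring

/-- Initial data that are continuous and vanish at the endpoints are uniform limits of initial data
of regular Dirichlet solutions of the heat equation. -/
theorem exists_regularDirichletHeatSol_approx (κ : ℝ) {L : ℝ} (hL : 0 < L) {f : ℝ → ℝ}
    (hf : ContinuousOn f (Set.Icc 0 L)) (hf0 : f 0 = 0) (hfL : f L = 0) {δ : ℝ} (hδ : 0 < δ) :
    ∃ u ut ux uxx, IsRegularDirichletHeatSol κ L u ut ux uxx ∧
      ∀ x ∈ Set.Icc 0 L, |f x - u 0 x| ≤ δ := by
  have : Fact (0 < 2 * L) := ⟨by linarith⟩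
  set F : ℝ → ℝ := Set.IccExtend hL.le ((Set.Icc 0 L).domRestrict f) with hFdef
  have hFc : Continuous F := (continuousOn_iff_continuous_domRestrict.1 hf).Icc_extend'
  have hFf : ∀ x ∈ Set.Icc 0 L, F x = f x := fun x hx => by
    rw [hFdef, Set.IccExtend_of_mem _ _ hx]; rfl
  have hFneg : ∀ x ≤ 0, F x = 0 := fun x hx => by
    rw [hFdef, Set.IccExtend_of_le_left _ _ hx]; exact hf0
  set g : ℝ → ℂ := fun x => ((F x - F (-x) : ℝ) : ℂ) with hg
  have hgc : Continuous g := by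
    have : Continuous fun x => F (-x) := hFc.comp continuous_neg
    exact Complex.continuous_ofReal.comp (hFc.sub this)
  have hgper : g (-L) = g (-L + 2 * L) := by
    have h1 : -L + 2 * L = L := by ring
    simp only [hg, h1, neg_neg, hFneg (-L) (by linarith), hFf L ⟨hL.le, le_rfl⟩, hfL]
  let G : C(AddCircle (2 * L), ℂ) :=
    ⟨AddCircle.liftIco (2 * L) (-L) g, AddCircle.liftIco_continuous hgper hgc.continuousOn⟩
  have hG : ∀ x ∈ Set.Ico (-L) L, G (x : AddCircle (2 * L)) = g x := fun x hx =>
    AddCircle.liftIco_coe_apply (f := g)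
      (show x ∈ Set.Ico (-L) (-L + 2 * L) from ⟨hx.1, by linarith [hx.2]⟩)
  have hmem : G ∈ closure
      (Submodule.span ℂ (Set.range (@fourier (2 * L))) : Set C(AddCircle (2 * L), ℂ)) := by
    have : G ∈ (Submodule.span ℂ (Set.range (@fourier (2 * L)))).topologicalClosure := by
      rw [span_fourier_closure_eq_top]; trivial
    exact this
  obtain ⟨p, hp, hGp⟩ := Metric.mem_closure_iff.1 hmem δ hδ
  obtain ⟨u, ut, ux, uxx, hu, hu0⟩ :=
    exists_regularDirichletHeatSol_of_mem_span_fourier κ hL.ne' hp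
  refine ⟨u, ut, ux, uxx, hu, fun x hx => ?_⟩
  rcases hx.2.eq_or_lt with h | hxL
  · subst h
    rw [hfL, hu.bcL, sub_zero, abs_zero]
    exact hδ.le
  have hclose : ∀ y ∈ Set.Ico (-L) L, |(g y - p (y : AddCircle (2 * L))).re| ≤ δ := fun y hy => by
    rw [← hG y hy]
    exact (Complex.abs_re_le_norm _).trans
      (((dist_eq_norm _ _).symm.le.trans (ContinuousMap.dist_apply_le_dist _)).trans hGp.le)
  have hgx : (g x).re = f x := by
    simp only [hg, Complex.ofReal_re, hFf x hx]
    rcases hx.1.eq_or_lt with h | h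
    · subst h; simp [hFneg 0 le_rfl, hf0]
    · rw [hFneg (-x) (by linarith), sub_zero]
  have hgnx : (g (-x)).re = - f x := by
    rw [← hgx]; simp [hg]
  have h1 := abs_le.1 (hclose x ⟨by linarith [hx.1], hxL⟩)
  have h2 := abs_le.1 (hclose (-x) ⟨by linarith, by linarith [hx.1]⟩)
  rw [Complex.sub_re, hgx] at h1
  rw [Complex.sub_re, hgnx] at h2
  rw [hu0, Complex.sub_re]
  exact abs_le.2 ⟨by linarith [h1.1, h2.2], by linarith [h1.2, h2.1]⟩

namespace IsDirichletHeatSol_s6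

variable {κ L : ℝ} {u ut ux uxx : ℝ → ℝ → ℝ}

theorem continuousOn_section (hu : IsDirichletHeatSol_s6 κ L u ut ux uxx) {t : ℝ} (ht : 0 ≤ t) :
    ContinuousOn (u t) (Set.Icc 0 L) :=
  hu.cont.comp (Continuous.prodMk_right t).continuousOn fun _ hx => ⟨ht, hx⟩

theorem integral_sq_le_initial_s6 (hκ : 0 < κ) (hL : 0 < L)
    (hu : IsDirichletHeatSol_s6 κ L u ut ux uxx) {t : ℝ} (ht : 0 ≤ t) :
    ∫ x in (0 : ℝ)..L, u t x ^ 2 ≤ ∫ x in (0 : ℝ)..L, u 0 x ^ 2 := by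
  obtain ⟨K, hK⟩ := ((isCompact_Icc (a := 0) (b := t)).prod
    (isCompact_Icc (a := (0 : ℝ)) (b := L))).exists_bound_of_continuousOn
      (hu.cont.mono (Set.prod_mono Set.Icc_subset_Ici_self subset_rfl))
  have hK0 : 0 ≤ K := (norm_nonneg _).trans
    (hK (0, 0) ⟨⟨le_rfl, ht⟩, le_rfl, hL.le⟩)
  have key : ∀ δ > 0, ∫ x in (0 : ℝ)..L, u t x ^ 2 ≤
      (∫ x in (0 : ℝ)..L, u 0 x ^ 2) + 2 * L * (δ * (2 * K + δ)) := by
    intro δ hδ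
    obtain ⟨v, vt, vx, vxx, hv, hv0⟩ := exists_regularDirichletHeatSol_approx κ hL
      (hu.continuousOn_section le_rfl) (hu.bc0 0 le_rfl) (hu.bcL 0 le_rfl) hδ
    have hsq : ∀ s ∈ Set.Icc 0 t, ∀ x ∈ Set.Icc 0 L,
        |u s x ^ 2 - v s x ^ 2| ≤ δ * (2 * K + δ) := by
      intro s hs x hx
      have h1 := hu.abs_sub_le hκ hv.isDirichletHeatSol hδ.le hv0 hs.1 hx
      have h2 : |u s x| ≤ K := hK (s, x) ⟨hs, hx⟩
      have h3 : |u s x + v s x| ≤ 2 * K + δ := by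
        rw [abs_le] at h1 h2 ⊢
        constructor <;> linarith [h1.1, h1.2, h2.1, h2.2]
      rw [sq_sub_sq, abs_mul, mul_comm]
      exact mul_le_mul h1 h3 (abs_nonneg _) hδ.le
    have hiu : ∀ s, 0 ≤ s → IntervalIntegrable (fun x => u s x ^ 2) volume 0 L := fun s hs =>
      ContinuousOn.intervalIntegrable (by
        rw [Set.uIcc_of_le hL.le]; exact (hu.continuousOn_section hs).pow 2)
    have hiv : ∀ s, 0 ≤ s → IntervalIntegrable (fun x => v s x ^ 2) volume 0 L := fun s hs =>
      ContinuousOn.intervalIntegrable (by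
        rw [Set.uIcc_of_le hL.le]; exact (hv.isDirichletHeatSol.continuousOn_section hs).pow 2)
    have hcmp : ∀ s ∈ Set.Icc 0 t, |(∫ x in (0 : ℝ)..L, u s x ^ 2) - ∫ x in (0 : ℝ)..L, v s x ^ 2|
        ≤ L * (δ * (2 * K + δ)) := by
      intro s hs
      rw [← intervalIntegral.integral_sub (hiu s hs.1) (hiv s hs.1)]
      have := intervalIntegral.norm_integral_le_of_norm_le_const (a := 0) (b := L)
        (f := fun x => u s x ^ 2 - v s x ^ 2) (C := δ * (2 * K + δ)) fun x hx => by
          rw [Set.uIoc_of_le hL.le] at hx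
          exact hsq s hs x ⟨hx.1.le, hx.2⟩
      rwa [sub_zero, abs_of_pos hL, mul_comm] at this
    have ha := abs_le.1 (hcmp t ⟨ht, le_rfl⟩)
    have hb := abs_le.1 (hcmp 0 ⟨le_rfl, ht⟩)
    have hc := hv.antitone_integral_sq hκ.le hL.le ht
    dsimp only at hc
    linarith [ha.2, hb.1]
  have hlim : Filter.Tendsto
      (fun δ : ℝ => (∫ x in (0 : ℝ)..L, u 0 x ^ 2) + 2 * L * (δ * (2 * K + δ)))
      (nhdsWithin 0 (Set.Ioi 0)) (nhds (∫ x in (0 : ℝ)..L, u 0 x ^ 2)) := by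
    have : Continuous fun δ : ℝ => (∫ x in (0 : ℝ)..L, u 0 x ^ 2) + 2 * L * (δ * (2 * K + δ)) := by
      fun_prop
    simpa using (this.tendsto 0).mono_left nhdsWithin_le_nhds
  exact ge_of_tendsto hlim (Filter.eventually_of_mem self_mem_nhdsWithin key)

theorem shift_s6 (hu : IsDirichletHeatSol_s6 κ L u ut ux uxx) {s : ℝ} (hs : 0 ≤ s) :
    IsDirichletHeatSol_s6 κ L (fun t => u (t + s)) (fun t => ut (t + s)) (fun t => ux (t + s))
      (fun t => uxx (t + s)) where
  cont := hu.cont.comp (f := fun p : ℝ × ℝ => (p.1 + s, p.2)) (by fun_prop)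
    fun p hp => ⟨add_nonneg hp.1 hs, hp.2⟩
  ht t h x hx := (hu.ht (t + s) (by linarith) x hx).comp_add_const t s
  hx t h := hu.hx (t + s) (by linarith)
  hxx t h := hu.hxx (t + s) (by linarith)
  heat t h := hu.heat (t + s) (by linarith)
  bc0 t h := hu.bc0 (t + s) (by linarith)
  bcL t h := hu.bcL (t + s) (by linarith)

/-- The `L²` norm of a Dirichlet solution of the heat equation does not increase. -/
theorem antitoneOn_integral_sq (hκ : 0 < κ) (hL : 0 < L)
    (hu : IsDirichletHeatSol_s6 κ L u ut ux uxx) :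
    AntitoneOn (fun t => ∫ x in (0 : ℝ)..L, u t x ^ 2) (Set.Ici 0) := by
  intro s hs t _ hst
  have := (hu.shift_s6 hs).integral_sq_le_initial_s6 hκ hL (sub_nonneg.2 hst)
  simpa using this

end IsDirichletHeatSol_s6

/-- Conjugation by `e^{M²t/(4ε) + Mx/(2ε)}` removes the transport term. -/
theorem IsAdjointTDSol.isDirichletHeatSol {L M ε : ℝ} (hε : ε ≠ 0) {ψ ψt ψx ψxx : ℝ → ℝ → ℝ}
    (hψ : IsAdjointTDSol L M ε ψ ψt ψx ψxx) :
    IsDirichletHeatSol_s6 ε L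
      (fun t x => Real.exp (M ^ 2 * t / (4 * ε) + M * x / (2 * ε)) * ψ t x)
      (fun t x => Real.exp (M ^ 2 * t / (4 * ε) + M * x / (2 * ε)) *
        (M ^ 2 / (4 * ε) * ψ t x + ψt t x))
      (fun t x => Real.exp (M ^ 2 * t / (4 * ε) + M * x / (2 * ε)) *
        (M / (2 * ε) * ψ t x + ψx t x))
      (fun t x => Real.exp (M ^ 2 * t / (4 * ε) + M * x / (2 * ε)) *
        (M / (2 * ε) * (M / (2 * ε) * ψ t x + ψx t x) + (M / (2 * ε) * ψx t x + ψxx t x))) := by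
  have hEt : ∀ t x, HasDerivAt (fun t => Real.exp (M ^ 2 * t / (4 * ε) + M * x / (2 * ε)))
      (Real.exp (M ^ 2 * t / (4 * ε) + M * x / (2 * ε)) * (M ^ 2 / (4 * ε))) t := by
    intro t x
    have h := ((((hasDerivAt_id t).const_mul (M ^ 2)).div_const (4 * ε)).add_const
      (M * x / (2 * ε))).exp
    simpa using h
  have hEx : ∀ t x, HasDerivAt (fun x => Real.exp (M ^ 2 * t / (4 * ε) + M * x / (2 * ε)))
      (Real.exp (M ^ 2 * t / (4 * ε) + M * x / (2 * ε)) * (M / (2 * ε))) x := by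
    intro t x
    have h := ((((hasDerivAt_id x).const_mul M).div_const (2 * ε)).const_add
      (M ^ 2 * t / (4 * ε))).exp
    simpa using h
  have hψx : ∀ t > 0, ∀ x ∈ Set.Ioo 0 L, HasDerivAt (ψ t) (ψx t x) x := fun t ht x hx =>
    (hψ.hx t ht x (Set.Ioo_subset_Icc_self hx)).hasDerivAt (Icc_mem_nhds hx.1 hx.2)
  have hψxx : ∀ t > 0, ∀ x ∈ Set.Ioo 0 L, HasDerivAt (ψx t) (ψxx t x) x := fun t ht x hx =>
    (hψ.hxx t ht x (Set.Ioo_subset_Icc_self hx)).hasDerivAt (Icc_mem_nhds hx.1 hx.2)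
  constructor
  · exact ContinuousOn.mul (by fun_prop) hψ.cont
  · intro t ht x hx
    refine ((hEt t x).mul (hψ.ht t ht x (Set.Ioo_subset_Icc_self hx))).congr_deriv ?_
    ring
  · intro t ht x hx
    refine ((hEx t x).mul (hψx t ht x hx)).congr_deriv ?_
    ring
  · intro t ht x hx
    refine ((hEx t x).mul (((hψx t ht x hx).const_mul (M / (2 * ε))).add
      (hψxx t ht x hx))).congr_deriv ?_
    rw [Pi.add_apply]
    ring
  · intro t ht x hx
    have h : ψt t x = ε * ψxx t x + M * ψx t x := by linarith [hψ.pde t ht x hx]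
    rw [h]
    field_simp
    ring
  · intro t ht
    simp [hψ.bc0 t ht]
  · intro t ht
    simp [hψ.bcL t ht]

/-- the intermediate estimate (inegint) of the paper.  Let `L > 0`,
`M ∈ ℝ`, `ε ∈ (0,1)`, `T > 0`, `a ∈ (0,1)`, `b ∈ (0,1]`, `C > 0`.  Let `ψ` be an
adjoint transport-diffusion solution and set
`φ(t,x) := e^{M²t/(4ε²) + Mx/(2ε)} ψ(t/ε, x)`, whose boundary normal derivative at
`x = 0` is `∂_x φ(t,0) = e^{M²t/(4ε²)} ψx(t/ε, 0)`.  Assume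
`∫_0^∞ ∫_0^L e^{-L²/(2t)} φ(t,x)² dx dt ≤ C ∫_0^{bεT} (∂_x φ(t,0))² dt`,
all integrals being finite.  Then
`(1-a) T e^{-L²/(2aεT) + M²T/(2ε)} ∫_0^L e^{Mx/ε} ψ(T,x)² dx
  ≤ C e^{bM²T/(2ε)} ∫_0^{bT} (∂_x ψ(t,0))² dt`. -/
theorem intermediate_estimate_inegint
    (L M ε T a b C : ℝ) (hL : 0 < L) (hε : ε ∈ Set.Ioo (0 : ℝ) 1) (hT : 0 < T)
    (ha : a ∈ Set.Ioo (0 : ℝ) 1) (hb : b ∈ Set.Ioc (0 : ℝ) 1) (hC : 0 < C)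
    (ψ ψt ψx ψxx : ℝ → ℝ → ℝ)
    (hψ : IsAdjointTDSol L M ε ψ ψt ψx ψxx)
    (hInt1 : IntegrableOn
      (fun t => ∫ x in (0 : ℝ)..L, Real.exp (-L ^ 2 / (2 * t)) *
        (Real.exp (M ^ 2 * t / (4 * ε ^ 2) + M * x / (2 * ε)) * ψ (t / ε) x) ^ 2)
      (Set.Ioi 0))
    (hInt2 : IntervalIntegrable
      (fun t => (Real.exp (M ^ 2 * t / (4 * ε ^ 2)) * ψx (t / ε) 0) ^ 2)
      volume 0 (b * ε * T))
    (hInt3 : IntervalIntegrable (fun t => (ψx t 0) ^ 2) volume 0 (b * T))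
    (hobs : (∫ t in Set.Ioi (0 : ℝ),
        ∫ x in (0 : ℝ)..L, Real.exp (-L ^ 2 / (2 * t)) *
          (Real.exp (M ^ 2 * t / (4 * ε ^ 2) + M * x / (2 * ε)) * ψ (t / ε) x) ^ 2) ≤
      C * ∫ t in (0 : ℝ)..(b * ε * T),
        (Real.exp (M ^ 2 * t / (4 * ε ^ 2)) * ψx (t / ε) 0) ^ 2) :
    (1 - a) * T * Real.exp (-L ^ 2 / (2 * a * ε * T) + M ^ 2 * T / (2 * ε)) *
        (∫ x in (0 : ℝ)..L, Real.exp (M * x / ε) * (ψ T x) ^ 2) ≤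
      C * Real.exp (b * M ^ 2 * T / (2 * ε)) *
        ∫ t in (0 : ℝ)..(b * T), (ψx t 0) ^ 2 := by
  obtain ⟨hε0, -⟩ := hε
  obtain ⟨ha0, ha1⟩ := ha
  obtain ⟨hb0, -⟩ := hb
  set F : ℝ → ℝ := fun s =>
    ∫ x in (0 : ℝ)..L, (Real.exp (M ^ 2 * s / (4 * ε) + M * x / (2 * ε)) * ψ s x) ^ 2 with hF
  have hanti : AntitoneOn F (Set.Ici 0) :=
    (hψ.isDirichletHeatSol hε0.ne').antitoneOn_integral_sq hε0 hL
  have hF0 : ∀ s, 0 ≤ F s := fun s =>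
    intervalIntegral.integral_nonneg hL.le fun x _ => sq_nonneg _
  have hinner : ∀ t, (∫ x in (0 : ℝ)..L, Real.exp (-L ^ 2 / (2 * t)) *
      (Real.exp (M ^ 2 * t / (4 * ε ^ 2) + M * x / (2 * ε)) * ψ (t / ε) x) ^ 2) =
      Real.exp (-L ^ 2 / (2 * t)) * F (t / ε) := by
    intro t
    rw [intervalIntegral.integral_const_mul, hF]
    have : M ^ 2 * t / (4 * ε ^ 2) = M ^ 2 * (t / ε) / (4 * ε) := by
      field_simp
    rw [this]
  simp only [hinner] at hInt1 hobs
  have hFT : F T = Real.exp (M ^ 2 * T / (2 * ε)) *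
      ∫ x in (0 : ℝ)..L, Real.exp (M * x / ε) * (ψ T x) ^ 2 := by
    rw [hF, ← intervalIntegral.integral_const_mul]
    refine intervalIntegral.integral_congr fun x _ => ?_
    rw [mul_pow, ← Real.exp_nat_mul, ← mul_assoc, ← Real.exp_add]
    congr 2
    push_cast
    field_simp
    ring
  have hεT : 0 < ε * T := mul_pos hε0 hT
  have hlow : (1 - a) * (ε * T) * (Real.exp (-L ^ 2 / (2 * a * ε * T)) * F T) ≤
      ∫ t in Set.Ioi (0 : ℝ), Real.exp (-L ^ 2 / (2 * t)) * F (t / ε) := by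
    have hsub : Set.Ioc (a * (ε * T)) (ε * T) ⊆ Set.Ioi 0 := fun t ht =>
      (mul_pos ha0 hεT).trans ht.1
    calc (1 - a) * (ε * T) * (Real.exp (-L ^ 2 / (2 * a * ε * T)) * F T)
        = ∫ _ in Set.Ioc (a * (ε * T)) (ε * T),
            Real.exp (-L ^ 2 / (2 * a * ε * T)) * F T := by
          rw [setIntegral_const, smul_eq_mul, measureReal_def, Real.volume_Ioc,
            ENNReal.toReal_ofReal (by nlinarith)]
          ring
      _ ≤ ∫ t in Set.Ioc (a * (ε * T)) (ε * T), Real.exp (-L ^ 2 / (2 * t)) * F (t / ε) := by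
          refine setIntegral_mono_on (integrableOn_const measure_Ioc_lt_top.ne)
            (hInt1.mono_set hsub) measurableSet_Ioc fun t ht => ?_
          have ht0 : 0 < t := hsub ht
          have hFt : F T ≤ F (t / ε) := by
            refine hanti (div_pos ht0 hε0).le hT.le ?_
            rw [div_le_iff₀ hε0, mul_comm]
            exact ht.2
          refine mul_le_mul (Real.exp_le_exp.2 ?_) hFt (hF0 T) (Real.exp_pos _).le
          rw [neg_div, neg_div, neg_le_neg_iff]
          refine div_le_div_of_nonneg_left (sq_nonneg L) (by positivity) ?_
          linarith [ht.1]
      _ ≤ _ := setIntegral_mono_set hInt1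
          (Filter.Eventually.of_forall fun t => mul_nonneg (Real.exp_pos _).le (hF0 _))
          hsub.eventuallyLE
  have hup : (∫ t in (0 : ℝ)..(b * ε * T),
        (Real.exp (M ^ 2 * t / (4 * ε ^ 2)) * ψx (t / ε) 0) ^ 2) ≤
      ε * (Real.exp (b * M ^ 2 * T / (2 * ε)) * ∫ t in (0 : ℝ)..(b * T), (ψx t 0) ^ 2) := by
    have hbεT : b * ε * T / ε = b * T := by field_simp
    have hpt : ∀ t ∈ Set.Icc 0 (b * ε * T),
        (Real.exp (M ^ 2 * t / (4 * ε ^ 2)) * ψx (t / ε) 0) ^ 2 ≤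
          Real.exp (b * M ^ 2 * T / (2 * ε)) * (ψx (t / ε) 0) ^ 2 := by
      intro t ht
      rw [mul_pow, ← Real.exp_nat_mul]
      refine mul_le_mul_of_nonneg_right (Real.exp_le_exp.2 ?_) (sq_nonneg _)
      calc ((2 : ℕ) : ℝ) * (M ^ 2 * t / (4 * ε ^ 2)) = M ^ 2 * t / (2 * ε ^ 2) := by
            push_cast
            field_simp
            ring
        _ ≤ M ^ 2 * (b * ε * T) / (2 * ε ^ 2) := by
            gcongr
            exact ht.2
        _ = b * M ^ 2 * T / (2 * ε) := by field_simp
    have hscale : IntervalIntegrable (fun t => (ψx (t / ε) 0) ^ 2) volume 0 (b * ε * T) := by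
      have h := hInt3.comp_mul_right (c := ε⁻¹)
      simpa [div_eq_mul_inv, mul_right_comm] using h
    calc (∫ t in (0 : ℝ)..(b * ε * T),
          (Real.exp (M ^ 2 * t / (4 * ε ^ 2)) * ψx (t / ε) 0) ^ 2)
        ≤ ∫ t in (0 : ℝ)..(b * ε * T),
            Real.exp (b * M ^ 2 * T / (2 * ε)) * (ψx (t / ε) 0) ^ 2 :=
          intervalIntegral.integral_mono_on (by positivity) hInt2 (hscale.const_mul _) hpt
      _ = ε * (Real.exp (b * M ^ 2 * T / (2 * ε)) * ∫ t in (0 : ℝ)..(b * T), (ψx t 0) ^ 2) := by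
          rw [intervalIntegral.integral_const_mul,
            intervalIntegral.integral_comp_div (fun t => (ψx t 0) ^ 2) hε0.ne', zero_div, hbεT,
            smul_eq_mul]
          ring
  refine le_of_mul_le_mul_left ?_ hε0
  rw [Real.exp_add]
  calc ε * ((1 - a) * T * (Real.exp (-L ^ 2 / (2 * a * ε * T)) * Real.exp (M ^ 2 * T / (2 * ε))) *
        ∫ x in (0 : ℝ)..L, Real.exp (M * x / ε) * (ψ T x) ^ 2)
      = (1 - a) * (ε * T) * (Real.exp (-L ^ 2 / (2 * a * ε * T)) * F T) := by rw [hFT]; ring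
    _ ≤ C * (ε * (Real.exp (b * M ^ 2 * T / (2 * ε)) *
          ∫ t in (0 : ℝ)..(b * T), (ψx t 0) ^ 2)) :=
        hlow.trans (hobs.trans (mul_le_mul_of_nonneg_left hup hC.le))
    _ = _ := by ring
end

section
/- Let L>0, M<0, T>0, ε∈(0,1), a∈(0,1), b∈(0,1], and C>0. Let ψ be an adjoint transport-diffusion solution, and assume the transformed function φ(t,x):=e^{M²t/(4ε²)+Mx/(2ε)}ψ(t/ε,x) satisfies ∫_0^∞∫_0^L e^{-L²/(2t)} φ(t,x)² dx dt ≤ C·∫_0^{bεT} (∂_xφ(t,0))² dt, with all integrals finite. Then ∫_0^L ψ(T,x)² dx ≤ (e^{(L²/(2aT) - M²T/2 + bM²T/2 + |M|L)/ε} / ((1-a)T))·C·∫_0^T (∂_xψ(t,0))² dt. -/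
open MeasureTheory

section Heat

open Set Topology

/-- `u` is continuous on `[s,T] × [0,L]` and solves the heat equation `u_t = κ u_xx` pointwise
on `(s,T] × (0,L)`. -/
def HeatOn (κ L s T : ℝ) (u : ℝ → ℝ → ℝ) : Prop :=
  ContinuousOn (fun p : ℝ × ℝ => u p.1 p.2) (Icc s T ×ˢ Icc 0 L) ∧
    ∃ ut ux uxx : ℝ → ℝ → ℝ, ∀ t ∈ Ioc s T, ∀ x ∈ Ioo 0 L,
      HasDerivAt (fun τ => u τ x) (ut t x) t ∧ HasDerivAt (u t) (ux t x) x ∧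
      HasDerivAt (ux t) (uxx t x) x ∧ ut t x = κ * uxx t x

lemma HeatOn.sub {κ L s T : ℝ} {u v : ℝ → ℝ → ℝ} (hu : HeatOn κ L s T u)
    (hv : HeatOn κ L s T v) : HeatOn κ L s T (fun t x => u t x - v t x) := by
  obtain ⟨huc, ut, ux, uxx, hu⟩ := hu
  obtain ⟨hvc, vt, vx, vxx, hv⟩ := hv
  refine ⟨huc.sub hvc, fun t x => ut t x - vt t x, fun t x => ux t x - vx t x,
    fun t x => uxx t x - vxx t x, fun t ht x hx => ?_⟩
  obtain ⟨h1, h2, h3, h4⟩ := hu t ht x hx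
  obtain ⟨k1, k2, k3, k4⟩ := hv t ht x hx
  exact ⟨h1.sub k1, h2.sub k2, h3.sub k3, by simp only [h4, k4]; ring⟩

lemma second_deriv_nonpos_of_isLocalMax {f f' : ℝ → ℝ} {x c : ℝ} (hmax : IsLocalMax f x)
    (hf : ∀ᶠ y in 𝓝 x, HasDerivAt f (f' y) y) (hf' : HasDerivAt f' c x) : c ≤ 0 := by
  by_contra! hc
  have hd : deriv f =ᶠ[𝓝 x] f' := hf.mono fun y hy => hy.deriv
  have h2 : deriv (deriv f) x = c := by rw [hd.deriv_eq, hf'.deriv]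
  have hmin : IsLocalMin f x :=
    isLocalMin_of_deriv_deriv_pos (h2 ▸ hc) hmax.deriv_eq_zero hf.self_of_nhds.continuousAt
  have hconst : f =ᶠ[𝓝 x] fun _ => f x := by
    filter_upwards [hmax, hmin] with y h1 h2 using le_antisymm h1 h2
  have h0 : deriv f =ᶠ[𝓝 x] fun _ => 0 := by
    filter_upwards [hconst.eventuallyEq_nhds] with y hy
    rw [hy.deriv_eq, deriv_const]
  rw [h0.deriv_eq, deriv_const] at h2
  exact hc.ne h2

lemma deriv_nonneg_of_left_le {f : ℝ → ℝ} {s t c : ℝ} (hst : s < t)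
    (hmax : ∀ τ ∈ Ioo s t, f τ ≤ f t) (hf : HasDerivAt f c t) : 0 ≤ c := by
  have h := hf.hasDerivWithinAt (s := Iio t)
  rw [hasDerivWithinAt_iff_tendsto_slope' (by simp)] at h
  refine ge_of_tendsto h ?_
  filter_upwards [Ioo_mem_nhdsLT hst] with τ hτ
  rw [slope_def_field]
  exact div_nonneg_of_nonpos (by linarith [hmax τ hτ]) (by linarith [hτ.2])

/-- Weak maximum principle on a rectangle. -/
lemma HeatOn.le_of_parabolic_boundary {κ L s T δ : ℝ} {u : ℝ → ℝ → ℝ} (hκ : 0 < κ)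
    (hu : HeatOn κ L s T u)
    (hs : ∀ x ∈ Icc 0 L, u s x ≤ δ) (h0 : ∀ t ∈ Icc s T, u t 0 ≤ δ)
    (hL : ∀ t ∈ Icc s T, u t L ≤ δ) {t x : ℝ} (ht : t ∈ Icc s T) (hx : x ∈ Icc 0 L) :
    u t x ≤ δ := by
  obtain ⟨huc, ut, ux, uxx, hu⟩ := hu
  have key : ∀ η > 0, u t x - η * (t - s) ≤ δ := by
    intro η hη
    have hzc : ContinuousOn (fun p : ℝ × ℝ => u p.1 p.2 - η * (p.1 - s))
        (Icc s T ×ˢ Icc 0 L) := huc.sub (by fun_prop)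
    obtain ⟨⟨t', x'⟩, ⟨ht', hx'⟩, hmax⟩ :=
      (isCompact_Icc.prod isCompact_Icc).exists_isMaxOn ⟨(t, x), ht, hx⟩ hzc
    refine (hmax (show (t, x) ∈ Icc s T ×ˢ Icc 0 L from ⟨ht, hx⟩)).trans ?_
    simp only at ht' hx' ⊢
    have hnn : 0 ≤ η * (t' - s) := mul_nonneg hη.le (by linarith [ht'.1])
    rcases ht'.1.eq_or_lt with e | hst
    · subst e; linarith [hs x' hx']
    rcases hx'.1.eq_or_lt with e | hx0
    · subst e; linarith [h0 t' ht']
    rcases hx'.2.eq_or_lt with e | hxL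
    · subst e; linarith [hL t' ht']
    exfalso
    obtain ⟨d1, d2, d3, d4⟩ := hu t' ⟨hst, ht'.2⟩ x' ⟨hx0, hxL⟩
    have e1 : 0 ≤ ut t' x' - η := by
      have hd : HasDerivAt (fun τ => u τ x' - η * (τ - s)) (ut t' x' - η) t' := by
        simpa using d1.fun_sub (((hasDerivAt_id t').sub_const s).const_mul η)
      refine deriv_nonneg_of_left_le hst (fun τ hτ => ?_) hd
      exact hmax (show (τ, x') ∈ Icc s T ×ˢ Icc 0 L from
        ⟨⟨hτ.1.le, hτ.2.le.trans ht'.2⟩, hx'⟩)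
    have e2 : uxx t' x' ≤ 0 := by
      refine second_deriv_nonpos_of_isLocalMax (f := u t') (f' := ux t') ?_ ?_ d3
      · filter_upwards [Ioo_mem_nhds hx0 hxL] with y hy
        have := hmax (show (t', y) ∈ Icc s T ×ˢ Icc 0 L from ⟨ht', hy.1.le, hy.2.le⟩)
        simpa using this
      · filter_upwards [Ioo_mem_nhds hx0 hxL] with y hy
        exact (hu t' ⟨hst, ht'.2⟩ y hy).2.1
    nlinarith [mul_nonneg hκ.le (neg_nonneg.2 e2)]
  refine le_of_forall_pos_le_add fun r hr => ?_
  have hd : 0 < t - s + 1 := by linarith [ht.1]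
  have h1 := key (r / (t - s + 1)) (by positivity)
  have h2 : r / (t - s + 1) * (t - s) ≤ r := by
    rw [div_mul_eq_mul_div, div_le_iff₀ hd]; nlinarith
  linarith

lemma HeatOn.abs_le_of_parabolic_boundary {κ L s T δ : ℝ} {u : ℝ → ℝ → ℝ} (hκ : 0 < κ)
    (hu : HeatOn κ L s T u)
    (hs : ∀ x ∈ Icc 0 L, |u s x| ≤ δ) (h0 : ∀ t ∈ Icc s T, |u t 0| ≤ δ)
    (hL : ∀ t ∈ Icc s T, |u t L| ≤ δ) {t x : ℝ} (ht : t ∈ Icc s T) (hx : x ∈ Icc 0 L) :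
    |u t x| ≤ δ := by
  refine abs_le'.2 ⟨hu.le_of_parabolic_boundary hκ (fun x hx => (abs_le'.1 (hs x hx)).1)
    (fun t ht => (abs_le'.1 (h0 t ht)).1) (fun t ht => (abs_le'.1 (hL t ht)).1) ht hx, ?_⟩
  have hz : HeatOn κ L s T (fun _ _ => 0) :=
    ⟨continuousOn_const, fun _ _ => 0, fun _ _ => 0, fun _ _ => 0, fun t _ x _ =>
      ⟨hasDerivAt_const _ _, hasDerivAt_const _ _, hasDerivAt_const _ _, by simp⟩⟩
  have := (hz.sub hu).le_of_parabolic_boundary hκ (δ := δ)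
    (fun x hx => by simpa using (abs_le'.1 (hs x hx)).2)
    (fun t ht => by simpa using (abs_le'.1 (h0 t ht)).2)
    (fun t ht => by simpa using (abs_le'.1 (hL t ht)).2) ht hx
  simpa using this

lemma exists_sine_sum_approx {L δ : ℝ} {f : ℝ → ℝ} (hL : 0 < L) (hf : ContinuousOn f (Icc 0 L))
    (hf0 : f 0 = 0) (hfL : f L = 0) (hδ : 0 < δ) :
    ∃ (s : Finset ℤ) (d : ℤ → ℝ), ∀ x ∈ Icc 0 L,
      |f x - ∑ n ∈ s, d n * Real.sin (n * Real.pi * x / L)| ≤ δ := by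
  have : Fact (0 < 2 * L) := ⟨by positivity⟩
  set e : ℝ → ℝ := IccExtend hL.le ((Icc 0 L).domRestrict f) with he
  have hec : Continuous e := hf.domRestrict.Icc_extend'
  have e_mem : ∀ x ∈ Icc 0 L, e x = f x := fun x hx => by
    rw [he, IccExtend_of_mem _ _ hx]; rfl
  have e_neg : ∀ x ≤ 0, e x = 0 := fun x hx => by
    rw [he, IccExtend_of_le_left _ _ hx]; exact hf0
  have e_L : e L = 0 := by rw [e_mem L ⟨hL.le, le_rfl⟩, hfL]
  set g : ℝ → ℂ := fun x => ((e x - e (-x) : ℝ) : ℂ) with hg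
  have hgc : Continuous g := by fun_prop
  have hgper : g (-L) = g (-L + 2 * L) := by
    have h1 : -L + 2 * L = L := by ring
    simp [hg, h1, e_L, e_neg (-L) (by linarith)]
  let G : C(AddCircle (2 * L), ℂ) :=
    ⟨AddCircle.liftIco (2 * L) (-L) g, AddCircle.liftIco_continuous hgper hgc.continuousOn⟩
  have hG : ∀ x ∈ Ico (-L) L, G (x : AddCircle (2 * L)) = g x := fun x hx => by
    change AddCircle.liftIco (2 * L) (-L) g x = g x
    exact AddCircle.liftIco_coe_apply ⟨hx.1, by linarith [hx.2]⟩
  have hmem : G ∈ closure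
      (Submodule.span ℂ (range (@fourier (2 * L))) : Set C(AddCircle (2 * L), ℂ)) := by
    rw [← Submodule.topologicalClosure_coe, span_fourier_closure_eq_top]; trivial
  obtain ⟨P, hP, hPG⟩ := Metric.mem_closure_iff.1 hmem δ hδ
  obtain ⟨c, rfl⟩ := Finsupp.mem_span_range_iff_exists_finsupp.1 hP
  set P : C(AddCircle (2 * L), ℂ) := c.sum fun n a => a • fourier n with hPdef
  refine ⟨c.support, fun n => -(c n).im, fun x hx => ?_⟩
  rcases hx.2.eq_or_lt with rfl | hxL
  · have : ∀ n : ℤ, Real.sin (n * Real.pi * x / x) = 0 := fun n => by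
      rw [mul_div_cancel_right₀ _ hL.ne', Real.sin_int_mul_pi]
    simp [this, hfL, hδ.le]
  have hdiff : ∀ y : AddCircle (2 * L), ‖G y - P y‖ ≤ δ := fun y => by
    rw [← dist_eq_norm]; exact (ContinuousMap.dist_apply_le_dist y).trans hPG.le
  have hPx : ((P (x : AddCircle (2 * L)) - P ((-x : ℝ) : AddCircle (2 * L))) / 2).re =
      ∑ n ∈ c.support, -(c n).im * Real.sin (n * Real.pi * x / L) := by
    have hL' : (L : ℂ) ≠ 0 := by exact_mod_cast hL.ne'
    have : (P (x : AddCircle (2 * L)) - P ((-x : ℝ) : AddCircle (2 * L))) / 2 =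
        ∑ n ∈ c.support, c n * (Complex.I * (Real.sin (n * Real.pi * x / L) : ℝ)) := by
      rw [hPdef, Finsupp.sum]
      simp only [ContinuousMap.coe_sum, Finset.sum_apply, ContinuousMap.coe_smul, Pi.smul_apply,
        fourier_coe_apply, smul_eq_mul]
      rw [← Finset.sum_sub_distrib, Finset.sum_div]
      refine Finset.sum_congr rfl fun n _ => ?_
      have h1 : 2 * (Real.pi : ℂ) * Complex.I * n * x / ((2 * L : ℝ) : ℂ) =
          (n * Real.pi * x / L) * Complex.I := by
        push_cast; field_simp
      have h2 : 2 * (Real.pi : ℂ) * Complex.I * n * ((-x : ℝ) : ℂ) / ((2 * L : ℝ) : ℂ) =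
          -(n * Real.pi * x / L) * Complex.I := by
        push_cast; field_simp
      rw [h1, h2]
      push_cast
      rw [Complex.sin]
      linear_combination (c n * (Complex.exp (-(n * Real.pi * x / L) * Complex.I) -
        Complex.exp ((n * Real.pi * x / L) * Complex.I)) / 2) * (-Complex.I_mul_I)
    rw [this, Complex.re_sum]
    refine Finset.sum_congr rfl fun n _ => ?_
    simp only [Complex.mul_re, Complex.mul_im, Complex.I_re, Complex.I_im, Complex.ofReal_re,
      Complex.ofReal_im]
    ring
  have hGx : ((G (x : AddCircle (2 * L)) - G ((-x : ℝ) : AddCircle (2 * L))) / 2).re = f x := by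
    rw [hG x ⟨by linarith [hx.1], hxL⟩, hG (-x) ⟨by linarith, by linarith [hx.1]⟩]
    simp only [hg, neg_neg, e_mem x hx, e_neg (-x) (by linarith [hx.1])]
    rw [← Complex.ofReal_sub]
    norm_cast
    ring
  rw [← hPx, ← hGx, ← Complex.sub_re]
  refine (Complex.abs_re_le_norm _).trans ?_
  have : (G (x : AddCircle (2 * L)) - G ((-x : ℝ) : AddCircle (2 * L))) / 2 -
      (P (x : AddCircle (2 * L)) - P ((-x : ℝ) : AddCircle (2 * L))) / 2 =
      ((G (x : AddCircle (2 * L)) - P (x : AddCircle (2 * L))) -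
      (G ((-x : ℝ) : AddCircle (2 * L)) - P ((-x : ℝ) : AddCircle (2 * L)))) / 2 := by ring
  rw [this, norm_div, Complex.norm_two, div_le_iff₀ two_pos]
  refine (norm_sub_le _ _).trans ?_
  linarith [hdiff x, hdiff ((-x : ℝ) : AddCircle (2 * L))]

lemma integral_sin_mul_sin_eq_zero {L : ℝ} (hL : 0 < L) {j k : ℤ} (hjk : j ^ 2 ≠ k ^ 2) :
    ∫ x in (0 : ℝ)..L, Real.sin (j * Real.pi * x / L) * Real.sin (k * Real.pi * x / L) = 0 := by
  have hcos : ∀ m : ℤ, m ≠ 0 → ∫ x in (0 : ℝ)..L, Real.cos (m * Real.pi / L * x) = 0 := by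
    intro m hm
    have hc : m * Real.pi / L ≠ 0 := by
      have : (m : ℝ) ≠ 0 := by exact_mod_cast hm
      have := Real.pi_ne_zero
      positivity
    rw [intervalIntegral.integral_comp_mul_left _ hc, integral_cos,
      div_mul_cancel₀ _ hL.ne', Real.sin_int_mul_pi]
    simp
  have h : ∀ x : ℝ, Real.sin (j * Real.pi * x / L) * Real.sin (k * Real.pi * x / L) =
      (Real.cos ((j - k : ℤ) * Real.pi / L * x) - Real.cos ((j + k : ℤ) * Real.pi / L * x)) / 2 := by
    intro x
    have h1 : ((j - k : ℤ) : ℝ) * Real.pi / L * x =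
        j * Real.pi * x / L - k * Real.pi * x / L := by push_cast; ring
    have h2 : ((j + k : ℤ) : ℝ) * Real.pi / L * x =
        j * Real.pi * x / L + k * Real.pi * x / L := by push_cast; ring
    rw [h1, h2, Real.cos_sub, Real.cos_add]
    ring
  simp_rw [h]
  rw [intervalIntegral.integral_div, intervalIntegral.integral_sub
    (Continuous.intervalIntegrable (by fun_prop) _ _)
    (Continuous.intervalIntegrable (by fun_prop) _ _), hcos, hcos]
  · simp
  · exact fun h0 => hjk (by rw [eq_neg_of_add_eq_zero_left h0, neg_sq])
  · exact fun h0 => hjk (by rw [sub_eq_zero.1 h0])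

lemma integral_sine_sum_sq {L : ℝ} (s : Finset ℤ) (d : ℤ → ℝ) :
    ∫ x in (0 : ℝ)..L, (∑ n ∈ s, d n * Real.sin (n * Real.pi * x / L)) ^ 2 =
      ∑ j ∈ s, ∑ k ∈ s, d j * d k * ∫ x in (0 : ℝ)..L,
        Real.sin (j * Real.pi * x / L) * Real.sin (k * Real.pi * x / L) := by
  simp_rw [sq, Finset.sum_mul_sum]
  rw [intervalIntegral.integral_finsetSum
    fun j _ => Continuous.intervalIntegrable (by fun_prop) _ _]
  refine Finset.sum_congr rfl fun j _ => ?_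
  rw [intervalIntegral.integral_finsetSum
    fun k _ => Continuous.intervalIntegrable (by fun_prop) _ _]
  refine Finset.sum_congr rfl fun k _ => ?_
  rw [← intervalIntegral.integral_const_mul]
  congr 1
  ext x
  ring

/-- Damping the coefficients of a sine sum by `exp (-μ n²)` does not increase its `L²` norm. -/
lemma integral_sine_sum_sq_damped_le {L μ : ℝ} (hL : 0 < L) (hμ : 0 ≤ μ) (s : Finset ℤ)
    (d : ℤ → ℝ) :
    ∫ x in (0 : ℝ)..L,
        (∑ n ∈ s, d n * Real.exp (-μ * n ^ 2) * Real.sin (n * Real.pi * x / L)) ^ 2 ≤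
      ∫ x in (0 : ℝ)..L, (∑ n ∈ s, d n * Real.sin (n * Real.pi * x / L)) ^ 2 := by
  set r : ℤ → ℝ := fun n => Real.sqrt (1 - Real.exp (-μ * n ^ 2) ^ 2) with hr
  have hr2 : ∀ n, r n * r n = 1 - Real.exp (-μ * n ^ 2) ^ 2 := fun n => by
    refine Real.mul_self_sqrt (sub_nonneg.2 (pow_le_one₀ (Real.exp_pos _).le ?_))
    rw [Real.exp_le_one_iff]
    nlinarith [mul_nonneg hμ (sq_nonneg (n : ℝ))]
  have hnn : 0 ≤ ∫ x in (0 : ℝ)..L,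
      (∑ n ∈ s, d n * r n * Real.sin (n * Real.pi * x / L)) ^ 2 :=
    intervalIntegral.integral_nonneg hL.le fun x _ => sq_nonneg _
  rw [← sub_nonneg]
  refine hnn.trans_eq ?_
  have e1 := integral_sine_sum_sq (L := L) s (fun n => d n * Real.exp (-μ * n ^ 2))
  have e2 := integral_sine_sum_sq (L := L) s (fun n => d n * r n)
  rw [e1, e2, integral_sine_sum_sq s d, ← Finset.sum_sub_distrib]
  refine Finset.sum_congr rfl fun j _ => ?_
  rw [← Finset.sum_sub_distrib]
  refine Finset.sum_congr rfl fun k _ => ?_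
  by_cases hjk : j ^ 2 = k ^ 2
  · have hjk' : (k : ℝ) ^ 2 = (j : ℝ) ^ 2 := by exact_mod_cast hjk.symm
    have hrk : r k = r j := by simp only [hr, hjk']
    rw [hrk, hjk']
    linear_combination (d j * d k * ∫ x in (0 : ℝ)..L,
      Real.sin (j * Real.pi * x / L) * Real.sin (k * Real.pi * x / L)) * hr2 j
  · rw [integral_sin_mul_sin_eq_zero hL hjk]; ring

lemma heatOn_sine_sum (κ L s T : ℝ) (S : Finset ℤ) (d : ℤ → ℝ) :
    HeatOn κ L s T fun t x => ∑ n ∈ S,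
      d n * Real.exp (-(κ * (Real.pi / L) ^ 2 * (t - s)) * n ^ 2) *
        Real.sin (n * Real.pi * x / L) := by
  refine ⟨Continuous.continuousOn (by fun_prop),
    fun t x => ∑ n ∈ S, d n * (Real.exp (-(κ * (Real.pi / L) ^ 2 * (t - s)) * n ^ 2) *
      (-(κ * (Real.pi / L) ^ 2) * n ^ 2)) * Real.sin (n * Real.pi * x / L),
    fun t x => ∑ n ∈ S, d n * Real.exp (-(κ * (Real.pi / L) ^ 2 * (t - s)) * n ^ 2) *
      (Real.cos (n * Real.pi * x / L) * (n * Real.pi / L)),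
    fun t x => ∑ n ∈ S, d n * Real.exp (-(κ * (Real.pi / L) ^ 2 * (t - s)) * n ^ 2) *
      (-Real.sin (n * Real.pi * x / L) * (n * Real.pi / L) * (n * Real.pi / L)),
    fun t _ x _ => ⟨?_, ?_, ?_, ?_⟩⟩
  · refine HasDerivAt.fun_sum fun n _ => HasDerivAt.mul_const (HasDerivAt.const_mul _ ?_) _
    refine HasDerivAt.exp ?_
    simpa using
      (((hasDerivAt_id t).sub_const s).const_mul (κ * (Real.pi / L) ^ 2)).fun_neg.mul_const
        ((n : ℝ) ^ 2)
  · refine HasDerivAt.fun_sum fun n _ => HasDerivAt.const_mul _ (HasDerivAt.sin ?_)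
    simpa using ((hasDerivAt_id x).const_mul (n * Real.pi)).div_const L
  · refine HasDerivAt.fun_sum fun n _ =>
      HasDerivAt.const_mul _ (HasDerivAt.mul_const (HasDerivAt.cos ?_) _)
    simpa using ((hasDerivAt_id x).const_mul (n * Real.pi)).div_const L
  · simp only [Finset.mul_sum]
    refine Finset.sum_congr rfl fun n _ => ?_
    ring

lemma integral_sq_le_of_abs_sub_le {L δ B : ℝ} {f g : ℝ → ℝ} (hL : 0 ≤ L)
    (hf : ContinuousOn f (Icc 0 L)) (hg : ContinuousOn g (Icc 0 L))
    (hfg : ∀ x ∈ Icc 0 L, |f x - g x| ≤ δ) (hB : ∀ x ∈ Icc 0 L, |f x + g x| ≤ B) :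
    ∫ x in (0 : ℝ)..L, f x ^ 2 ≤ (∫ x in (0 : ℝ)..L, g x ^ 2) + L * (δ * B) := by
  have hc : L * (δ * B) = ∫ _ in (0 : ℝ)..L, δ * B := by
    rw [intervalIntegral.integral_const, sub_zero, smul_eq_mul]
  have ig : IntervalIntegrable (fun x => g x ^ 2) volume 0 L :=
    (hg.pow 2).intervalIntegrable_of_Icc hL
  rw [hc, ← intervalIntegral.integral_add ig (by simp)]
  refine intervalIntegral.integral_mono_on hL ((hf.pow 2).intervalIntegrable_of_Icc hL)
    (ig.add (by simp)) fun x hx => ?_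
  have h := mul_le_mul (hfg x hx) (hB x hx) (abs_nonneg _) ((abs_nonneg _).trans (hfg x hx))
  rw [← abs_mul] at h
  nlinarith [le_abs_self ((f x - g x) * (f x + g x))]

/-- The `L²` norm of a classical solution of the Dirichlet heat equation does not increase. -/
lemma HeatOn.integral_sq_le {κ L s T : ℝ} {u : ℝ → ℝ → ℝ} (hκ : 0 < κ) (hL : 0 < L) (hsT : s ≤ T)
    (hu : HeatOn κ L s T u) (h0 : ∀ t ∈ Icc s T, u t 0 = 0) (hL0 : ∀ t ∈ Icc s T, u t L = 0) :
    ∫ x in (0 : ℝ)..L, u T x ^ 2 ≤ ∫ x in (0 : ℝ)..L, u s x ^ 2 := by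
  have hcont : ∀ t ∈ Icc s T, ContinuousOn (u t) (Icc 0 L) := fun t ht =>
    hu.1.comp (f := fun x => (t, x)) (by fun_prop) fun x hx => ⟨ht, hx⟩
  have hs : s ∈ Icc s T := ⟨le_rfl, hsT⟩
  have hT : T ∈ Icc s T := ⟨hsT, le_rfl⟩
  obtain ⟨B, hB⟩ := (isCompact_Icc.prod isCompact_Icc).exists_bound_of_continuousOn hu.1
  have hB' : ∀ t ∈ Icc s T, ∀ x ∈ Icc 0 L, |u t x| ≤ B := fun t ht x hx => hB (t, x) ⟨ht, hx⟩
  have hB0 : 0 ≤ B := (abs_nonneg _).trans (hB' s hs 0 ⟨le_rfl, hL.le⟩)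
  have key : ∀ δ ∈ Ioc (0 : ℝ) 1, ∫ x in (0 : ℝ)..L, u T x ^ 2 ≤
      (∫ x in (0 : ℝ)..L, u s x ^ 2) + 2 * L * (2 * B + 1) * δ := by
    intro δ hδ
    obtain ⟨S, d, hd⟩ := exists_sine_sum_approx hL (hcont s hs) (h0 s hs) (hL0 s hs) hδ.1
    set v : ℝ → ℝ → ℝ := fun t x => ∑ n ∈ S,
      d n * Real.exp (-(κ * (Real.pi / L) ^ 2 * (t - s)) * n ^ 2) *
        Real.sin (n * Real.pi * x / L) with hv
    have hvs : v s = fun x => ∑ n ∈ S, d n * Real.sin (n * Real.pi * x / L) := by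
      ext x; simp [hv]
    have hvc : ∀ t, ContinuousOn (v t) (Icc 0 L) := fun t =>
      Continuous.continuousOn (by fun_prop)
    have hv0 : ∀ t, v t 0 = 0 := fun t => by simp [hv]
    have hvL : ∀ t, v t L = 0 := fun t => by
      have : ∀ n : ℤ, Real.sin (n * Real.pi * L / L) = 0 := fun n => by
        rw [mul_div_cancel_right₀ _ hL.ne', Real.sin_int_mul_pi]
      simp [hv, this]
    have hdiff : ∀ t ∈ Icc s T, ∀ x ∈ Icc 0 L, |u t x - v t x| ≤ δ := fun t ht x hx =>
      (hu.sub (heatOn_sine_sum κ L s T S d)).abs_le_of_parabolic_boundary hκ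
        (fun x hx => by simpa using hd x hx)
        (fun t ht => by
          change |u t 0 - v t 0| ≤ δ
          rw [h0 t ht, hv0 t]; simpa using hδ.1.le)
        (fun t ht => by
          change |u t L - v t L| ≤ δ
          rw [hL0 t ht, hvL t]; simpa using hδ.1.le) ht hx
    have hsum : ∀ t ∈ Icc s T, ∀ x ∈ Icc 0 L, |u t x + v t x| ≤ 2 * B + 1 := by
      intro t ht x hx
      have h1 := abs_le.1 (hdiff t ht x hx)
      have h2 := abs_le.1 (hB' t ht x hx)
      rw [abs_le]
      constructor <;> linarith [h1.1, h1.2, h2.1, h2.2, hδ.2]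
    have i1 := integral_sq_le_of_abs_sub_le hL.le (hcont T hT) (hvc T) (hdiff T hT) (hsum T hT)
    have i2 : ∫ x in (0 : ℝ)..L, v T x ^ 2 ≤ ∫ x in (0 : ℝ)..L, v s x ^ 2 := by
      rw [hvs]
      exact integral_sine_sum_sq_damped_le hL
        (mul_nonneg (by positivity) (sub_nonneg.2 hsT)) S d
    have i3 := integral_sq_le_of_abs_sub_le hL.le (hvc s) (hcont s hs)
      (fun x hx => by rw [abs_sub_comm]; exact hdiff s hs x hx)
      (fun x hx => by rw [add_comm]; exact hsum s hs x hx)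
    linarith
  refine ge_of_tendsto (x := 𝓝[>] (0 : ℝ)) (f := fun δ =>
    (∫ x in (0 : ℝ)..L, u s x ^ 2) + 2 * L * (2 * B + 1) * δ) ?_
    (Filter.mem_of_superset (Ioc_mem_nhdsGT one_pos) key)
  refine tendsto_nhdsWithin_of_tendsto_nhds ?_
  have hct : Continuous fun δ : ℝ =>
    (∫ x in (0 : ℝ)..L, u s x ^ 2) + 2 * L * (2 * B + 1) * δ := by fun_prop
  simpa using hct.tendsto 0

lemma IsAdjointTDSol.heatOn {L M ε s T : ℝ} {ψ ψt ψx ψxx : ℝ → ℝ → ℝ}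
    (hψ : IsAdjointTDSol L M ε ψ ψt ψx ψxx) (hε : 0 < ε) (hs : 0 < s) :
    HeatOn ε L s T fun t x => Real.exp (M ^ 2 * t / (4 * ε) + M * x / (2 * ε)) * ψ t x := by
  refine ⟨ContinuousOn.mul (Continuous.continuousOn (by fun_prop))
      (hψ.cont.mono (prod_mono (fun t ht => hs.le.trans ht.1) subset_rfl)),
    fun t x => Real.exp (M ^ 2 * t / (4 * ε) + M * x / (2 * ε)) * (M ^ 2 / (4 * ε)) * ψ t x +
      Real.exp (M ^ 2 * t / (4 * ε) + M * x / (2 * ε)) * ψt t x,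
    fun t x => Real.exp (M ^ 2 * t / (4 * ε) + M * x / (2 * ε)) * (M / (2 * ε)) * ψ t x +
      Real.exp (M ^ 2 * t / (4 * ε) + M * x / (2 * ε)) * ψx t x,
    fun t x => Real.exp (M ^ 2 * t / (4 * ε) + M * x / (2 * ε)) * (M / (2 * ε)) * (M / (2 * ε)) *
        ψ t x +
      Real.exp (M ^ 2 * t / (4 * ε) + M * x / (2 * ε)) * (M / (2 * ε)) * ψx t x +
      (Real.exp (M ^ 2 * t / (4 * ε) + M * x / (2 * ε)) * (M / (2 * ε)) * ψx t x +
      Real.exp (M ^ 2 * t / (4 * ε) + M * x / (2 * ε)) * ψxx t x),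
    fun t ht x hx => ?_⟩
  have ht0 : 0 < t := hs.trans ht.1
  have hxI := Ioo_subset_Icc_self hx
  have hnhds := Icc_mem_nhds hx.1 hx.2
  have d1 := hψ.ht t ht0 x hxI
  have d2 := (hψ.hx t ht0 x hxI).hasDerivAt hnhds
  have d3 := (hψ.hxx t ht0 x hxI).hasDerivAt hnhds
  have et : HasDerivAt (fun τ => Real.exp (M ^ 2 * τ / (4 * ε) + M * x / (2 * ε)))
      (Real.exp (M ^ 2 * t / (4 * ε) + M * x / (2 * ε)) * (M ^ 2 / (4 * ε))) t := by
    refine HasDerivAt.exp ?_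
    simpa using (((hasDerivAt_id t).const_mul (M ^ 2)).div_const (4 * ε)).add_const
      (M * x / (2 * ε))
  have ex : HasDerivAt (fun ξ => Real.exp (M ^ 2 * t / (4 * ε) + M * ξ / (2 * ε)))
      (Real.exp (M ^ 2 * t / (4 * ε) + M * x / (2 * ε)) * (M / (2 * ε))) x := by
    refine HasDerivAt.exp ?_
    simpa using (((hasDerivAt_id x).const_mul M).div_const (2 * ε)).const_add
      (M ^ 2 * t / (4 * ε))
  refine ⟨et.fun_mul d1, ex.fun_mul d2,
    ((ex.mul_const (M / (2 * ε))).fun_mul d2).fun_add (ex.fun_mul d3), ?_⟩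
  have hpde : ψt t x = ε * ψxx t x + M * ψx t x := by linarith [hψ.pde t ht0 x hx]
  simp only [hpde]
  field_simp
  ring

/-- The weighted energy `∫ e^{M²t/(2ε) + Mx/ε} ψ²` is nonincreasing in `t`. -/
lemma IsAdjointTDSol.weighted_energy_le {L M ε s T : ℝ} {ψ ψt ψx ψxx : ℝ → ℝ → ℝ}
    (hψ : IsAdjointTDSol L M ε ψ ψt ψx ψxx) (hε : 0 < ε) (hL : 0 < L) (hs : 0 < s) (hsT : s ≤ T) :
    ∫ x in (0 : ℝ)..L, (Real.exp (M ^ 2 * T / (4 * ε) + M * x / (2 * ε)) * ψ T x) ^ 2 ≤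
      ∫ x in (0 : ℝ)..L, (Real.exp (M ^ 2 * s / (4 * ε) + M * x / (2 * ε)) * ψ s x) ^ 2 :=
  (hψ.heatOn hε hs).integral_sq_le hε hL hsT
    (fun t ht => by simp [hψ.bc0 t (hs.le.trans ht.1)])
    (fun t ht => by simp [hψ.bcL t (hs.le.trans ht.1)])

end Heat

/-- estimate (estez3) of the paper (case `M < 0`).  Let `L > 0`,
`M < 0`, `T > 0`, `ε ∈ (0,1)`, `a ∈ (0,1)`, `b ∈ (0,1]`, `C > 0`.  Let `ψ` be an
adjoint transport-diffusion solution and assume the transformed function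
`φ(t,x) := e^{M²t/(4ε²) + Mx/(2ε)} ψ(t/ε, x)` (whose boundary normal derivative at
`x = 0` is `∂_x φ(t,0) = e^{M²t/(4ε²)} ψx(t/ε, 0)`) satisfies
`∫_0^∞ ∫_0^L e^{-L²/(2t)} φ(t,x)² dx dt ≤ C ∫_0^{bεT} (∂_x φ(t,0))² dt`,
all integrals being finite.  Then
`∫_0^L ψ(T,x)² dx ≤ (e^{(L²/(2aT) - M²T/2 + bM²T/2 + |M|L)/ε} / ((1-a)T)) · C ·
  ∫_0^T (∂_x ψ(t,0))² dt`. -/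
theorem estimate_estez3
    (L M ε T a b C : ℝ) (hL : 0 < L) (hM : M < 0) (hT : 0 < T)
    (hε : ε ∈ Set.Ioo (0 : ℝ) 1) (ha : a ∈ Set.Ioo (0 : ℝ) 1)
    (hb : b ∈ Set.Ioc (0 : ℝ) 1) (hC : 0 < C)
    (ψ ψt ψx ψxx : ℝ → ℝ → ℝ)
    (hψ : IsAdjointTDSol L M ε ψ ψt ψx ψxx)
    (hInt1 : IntegrableOn
      (fun t => ∫ x in (0 : ℝ)..L, Real.exp (-L ^ 2 / (2 * t)) *
        (Real.exp (M ^ 2 * t / (4 * ε ^ 2) + M * x / (2 * ε)) * ψ (t / ε) x) ^ 2)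
      (Set.Ioi 0))
    (hInt2 : IntervalIntegrable
      (fun t => (Real.exp (M ^ 2 * t / (4 * ε ^ 2)) * ψx (t / ε) 0) ^ 2)
      volume 0 (b * ε * T))
    (hInt3 : IntervalIntegrable (fun t => (ψx t 0) ^ 2) volume 0 T)
    (hobs : (∫ t in Set.Ioi (0 : ℝ),
        ∫ x in (0 : ℝ)..L, Real.exp (-L ^ 2 / (2 * t)) *
          (Real.exp (M ^ 2 * t / (4 * ε ^ 2) + M * x / (2 * ε)) * ψ (t / ε) x) ^ 2) ≤
      C * ∫ t in (0 : ℝ)..(b * ε * T),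
        (Real.exp (M ^ 2 * t / (4 * ε ^ 2)) * ψx (t / ε) 0) ^ 2) :
    (∫ x in (0 : ℝ)..L, (ψ T x) ^ 2) ≤
      (Real.exp ((L ^ 2 / (2 * a * T) - M ^ 2 * T / 2 + b * M ^ 2 * T / 2 + |M| * L)
            / ε) / ((1 - a) * T)) * C *
        ∫ t in (0 : ℝ)..T, (ψx t 0) ^ 2 := by
  obtain ⟨hε0, -⟩ := hε
  obtain ⟨ha0, ha1⟩ := ha
  obtain ⟨hb0, hb1⟩ := hb
  have hψc : ContinuousOn (ψ T) (Set.Icc 0 L) :=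
    hψ.cont.comp (f := fun x => (T, x)) (by fun_prop) fun x hx => ⟨hT.le, hx⟩
  set J := ∫ x in (0 : ℝ)..L, (ψ T x) ^ 2
  set K := ∫ t in (0 : ℝ)..T, (ψx t 0) ^ 2
  -- lower bound for the weighted energy at time `T`
  have hlow : Real.exp (M ^ 2 * T / (2 * ε) - |M| * L / ε) * J ≤
      ∫ x in (0 : ℝ)..L, (Real.exp (M ^ 2 * T / (4 * ε) + M * x / (2 * ε)) * ψ T x) ^ 2 := by
    rw [← intervalIntegral.integral_const_mul]
    refine intervalIntegral.integral_mono_on hL.le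
      (ContinuousOn.intervalIntegrable_of_Icc hL.le (continuousOn_const.mul (hψc.pow 2)))
      (ContinuousOn.intervalIntegrable_of_Icc hL.le
        ((ContinuousOn.mul (Continuous.continuousOn (by fun_prop)) hψc).pow 2)) fun x hx => ?_
    rw [mul_pow, ← Real.exp_nat_mul]
    refine mul_le_mul_of_nonneg_right (Real.exp_le_exp.2 ?_) (sq_nonneg _)
    have h1 : ((2 : ℕ) : ℝ) * (M ^ 2 * T / (4 * ε) + M * x / (2 * ε)) =
        M ^ 2 * T / (2 * ε) - -M * x / ε := by push_cast; field_simp; ring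
    rw [h1, abs_of_neg hM]
    gcongr
    · linarith
    · exact hx.2
  -- lower bound for the observed energy
  set G : ℝ → ℝ := fun t => ∫ x in (0 : ℝ)..L, Real.exp (-L ^ 2 / (2 * t)) *
        (Real.exp (M ^ 2 * t / (4 * ε ^ 2) + M * x / (2 * ε)) * ψ (t / ε) x) ^ 2 with hG
  have hG0 : ∀ t, 0 ≤ G t := fun t =>
    intervalIntegral.integral_nonneg hL.le fun x _ => by positivity
  set c := Real.exp (-L ^ 2 / (2 * (a * ε * T))) *
    (Real.exp (M ^ 2 * T / (2 * ε) - |M| * L / ε) * J) with hc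
  have hGc : ∀ t ∈ Set.Ioc (a * ε * T) (ε * T), c ≤ G t := by
    intro t ht
    have haεT : 0 < a * ε * T := by positivity
    have ht0 : 0 < t := haεT.trans ht.1
    have hE := hψ.weighted_energy_le hε0 hL (s := t / ε) (T := T) (by positivity)
      (by rw [div_le_iff₀ hε0]; linarith [ht.2])
    have h1 : M ^ 2 * (t / ε) / (4 * ε) = M ^ 2 * t / (4 * ε ^ 2) := by field_simp
    rw [h1] at hE
    rw [hG]
    simp only [intervalIntegral.integral_const_mul]
    refine mul_le_mul (Real.exp_le_exp.2 ?_) (hlow.trans hE) ?_ (Real.exp_pos _).le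
    · rw [neg_div, neg_div, neg_le_neg_iff]
      have := ht.1.le
      gcongr
    · exact mul_nonneg (Real.exp_pos _).le
        (intervalIntegral.integral_nonneg hL.le fun x _ => sq_nonneg _)
  have hLHS : (1 - a) * (ε * T) * c ≤ ∫ t in Set.Ioi (0 : ℝ), G t := by
    have hsub : Set.Ioc (a * ε * T) (ε * T) ⊆ Set.Ioi 0 := fun t ht =>
      lt_trans (by positivity : 0 < a * ε * T) ht.1
    have hle : a * ε * T ≤ ε * T := by nlinarith [mul_pos hε0 hT]
    calc (1 - a) * (ε * T) * c = ∫ _ in Set.Ioc (a * ε * T) (ε * T), c := by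
          rw [← intervalIntegral.integral_of_le hle, intervalIntegral.integral_const, smul_eq_mul]
          ring
      _ ≤ ∫ t in Set.Ioc (a * ε * T) (ε * T), G t :=
          setIntegral_mono_on (by simp) (hInt1.mono_set hsub) measurableSet_Ioc hGc
      _ ≤ ∫ t in Set.Ioi (0 : ℝ), G t :=
          setIntegral_mono_set hInt1 (Filter.Eventually.of_forall hG0) hsub.eventuallyLE
  -- upper bound for the boundary term
  have hbT : b * T ≤ T := by nlinarith
  have hbT0 : 0 ≤ b * T := by positivity
  have hRHS : ∫ t in (0 : ℝ)..(b * ε * T),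
      (Real.exp (M ^ 2 * t / (4 * ε ^ 2)) * ψx (t / ε) 0) ^ 2 ≤
        ε * (Real.exp (b * M ^ 2 * T / (2 * ε)) * K) := by
    have hcv := intervalIntegral.integral_comp_div (a := 0) (b := b * ε * T)
      (fun t => (Real.exp (M ^ 2 * t / (4 * ε)) * ψx t 0) ^ 2) hε0.ne'
    have h1 : ∀ t, M ^ 2 * (t / ε) / (4 * ε) = M ^ 2 * t / (4 * ε ^ 2) := fun t => by field_simp
    have h2 : b * ε * T / ε = b * T := by field_simp
    simp only [h1, h2, zero_div, smul_eq_mul] at hcv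
    rw [hcv]
    refine mul_le_mul_of_nonneg_left ?_ hε0.le
    have hi : IntervalIntegrable (fun t => (ψx t 0) ^ 2) volume 0 (b * T) :=
      hInt3.mono_set (Set.uIcc_subset_uIcc_left (by rw [Set.uIcc_of_le hT.le]; exact ⟨hbT0, hbT⟩))
    have hi' : IntervalIntegrable
        (fun t => (Real.exp (M ^ 2 * t / (4 * ε)) * ψx t 0) ^ 2) volume 0 (b * T) := by
      simp_rw [mul_pow]
      exact hi.continuousOn_mul (Continuous.continuousOn (by fun_prop))
    calc ∫ t in (0 : ℝ)..(b * T), (Real.exp (M ^ 2 * t / (4 * ε)) * ψx t 0) ^ 2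
        ≤ ∫ t in (0 : ℝ)..(b * T), Real.exp (b * M ^ 2 * T / (2 * ε)) * (ψx t 0) ^ 2 := by
          refine intervalIntegral.integral_mono_on hbT0 hi' (hi.const_mul _) fun t ht => ?_
          rw [mul_pow, ← Real.exp_nat_mul]
          refine mul_le_mul_of_nonneg_right (Real.exp_le_exp.2 ?_) (sq_nonneg _)
          have h3 : ((2 : ℕ) : ℝ) * (M ^ 2 * t / (4 * ε)) = M ^ 2 * t / (2 * ε) := by
            push_cast; field_simp; ring
          rw [h3]
          have h4 := mul_le_mul_of_nonneg_left ht.2 (sq_nonneg M)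
          refine div_le_div_of_nonneg_right ?_ (by positivity)
          linarith
      _ = Real.exp (b * M ^ 2 * T / (2 * ε)) * ∫ t in (0 : ℝ)..(b * T), (ψx t 0) ^ 2 :=
          intervalIntegral.integral_const_mul _ _
      _ ≤ Real.exp (b * M ^ 2 * T / (2 * ε)) * K := by
          refine mul_le_mul_of_nonneg_left ?_ (Real.exp_pos _).le
          exact intervalIntegral.integral_mono_interval le_rfl hbT0 hbT
            (Filter.Eventually.of_forall fun t => sq_nonneg _) hInt3
  have hmain : (1 - a) * (ε * T) * c ≤ C * (ε * (Real.exp (b * M ^ 2 * T / (2 * ε)) * K)) :=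
    hLHS.trans (hobs.trans (mul_le_mul_of_nonneg_left hRHS hC.le))
  set p := -L ^ 2 / (2 * (a * ε * T)) + (M ^ 2 * T / (2 * ε) - |M| * L / ε) with hp
  have hcp : c = Real.exp p * J := by rw [hc, hp, Real.exp_add]; ring
  have hexp : Real.exp ((L ^ 2 / (2 * a * T) - M ^ 2 * T / 2 + b * M ^ 2 * T / 2 + |M| * L) / ε) =
      Real.exp (b * M ^ 2 * T / (2 * ε)) / Real.exp p := by
    rw [← Real.exp_sub, hp]
    congr 1
    field_simp
    ring
  have h1a : 0 < 1 - a := by linarith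
  rw [hexp, div_div, div_mul_eq_mul_div, div_mul_eq_mul_div, le_div_iff₀ (by positivity)]
  rw [hcp] at hmain
  refine le_of_mul_le_mul_left ?_ hε0
  linarith
end
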